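/- arXiv:1410.5701 — 2 statements merged into one kernel-verified Lean document; each statement's English description precedes it below -/
import Mathlib

section
/- Let K be a half-plane hull with hydrodynamic conformal map f : ℍ → ℍ \ K, and suppose K ⊂ B(x,r) for some x ∈ ℝ and r > 0. Then for every w ∈ ℍ with |w − x| ≥ 2r one has |f(w) − x| ≥ r; that is, ℍ \ B(x,2r) ⊂ f⁻¹(ℍ \ B(x,r)). -/
open Set Metric Filter Bornology Complex Function

noncomputable section

/-- The upper half-plane as a subset of `ℂ`. -/
def UHP : Set ℂ := {z : ℂ | 0 < z.im}

/-- `K` is a half-plane hull: a bounded subset of the upper half-plane whose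
complement in the upper half-plane is a simply connected domain. -/
def IsHull (K : Set ℂ) : Prop :=
  IsBounded K ∧ K ⊆ UHP ∧ IsOpen (UHP \ K) ∧ IsConnected (UHP \ K) ∧
    SimplyConnectedSpace ↥(UHP \ K)

/-- `f` is the hydrodynamic conformal map of the hull `K`: a conformal bijection
from the upper half-plane onto `UHP \ K` with `f z - z → 0` as `|z| → ∞` in `UHP`. -/
def IsHydroMap (K : Set ℂ) (f : ℂ → ℂ) : Prop :=
  DifferentiableOn ℂ f UHP ∧ InjOn f UHP ∧ f '' UHP = UHP \ K ∧
    Tendsto (fun z => f z - z) (cobounded ℂ ⊓ 𝓟 UHP) (nhds (0 : ℂ))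

/-- `f` is the hydrodynamic map of `K` and `g` is its inverse. -/
def IsHydroPair (K : Set ℂ) (f g : ℂ → ℂ) : Prop :=
  IsHydroMap K f ∧ InvOn g f UHP (UHP \ K)

/-- `K` has half-plane capacity `a`, computed via its hydrodynamic map `f`:
`z * (z - f z) → a` as `|z| → ∞` in `UHP`. -/
def HasHcap (K : Set ℂ) (f : ℂ → ℂ) (a : ℝ) : Prop :=
  Tendsto (fun z => z * (z - f z)) (cobounded ℂ ⊓ 𝓟 UHP) (nhds (a : ℂ))

/-- The `(β, C₀)`-Hölder condition for a map defined on the upper half-plane. -/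
def IsHolder (f : ℂ → ℂ) (β C₀ : ℝ) : Prop :=
  ∀ z ∈ UHP, ∀ z' ∈ UHP, dist (f z) (f z') ≤ C₀ * max (dist z z' ^ β) (dist z z')

/-- The Poincaré hyperbolic distance on the upper half-plane. -/
def rhoH (z w : ℂ) : ℝ :=
  2 * Real.arsinh (dist z w / (2 * Real.sqrt (z.im * w.im)))

/-- The hyperbolic distance on a simply connected domain `Ω`, transported through a
conformal bijection `φ : UHP → Ω` (independent of the choice of `φ`). -/
def rhoVia (φ : ℂ → ℂ) (z w : ℂ) : ℝ :=
  rhoH (invFunOn φ UHP z) (invFunOn φ UHP w)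

/-- `log⁺ x = max (log x) 0`. -/
def posLog (x : ℝ) : ℝ := max (Real.log x) 0

/-- Internal distance between `A` and `B` inside `Ω`: the infimum of diameters of
connected subsets of `Ω` meeting both `A` and `B`. -/
def distIn (Ω A B : Set ℂ) : ℝ :=
  sInf {d : ℝ | ∃ E : Set ℂ, E ⊆ Ω ∧ IsConnected E ∧ (E ∩ A).Nonempty ∧
    (E ∩ B).Nonempty ∧ d = Metric.diam E}

/-- Internal diameter of `A` inside `Ω`. -/
def diamIn (Ω A : Set ℂ) : ℝ :=
  sSup {d : ℝ | ∃ a ∈ A, ∃ b ∈ A, d = distIn Ω {a} {b}}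

/-- An `L`-John curve in `Ω` with tip `z`, parametrized on `[0,1)` (the base-point,
which is not required to lie in `Ω`, corresponds to the missing endpoint). -/
def IsJohnCurve (Ω : Set ℂ) (L : ℝ) (α : ℝ → ℂ) (z : ℂ) : Prop :=
  ContinuousOn α (Ico 0 1) ∧ InjOn α (Ico 0 1) ∧ α 0 = z ∧
    MapsTo α (Ico 0 1) Ω ∧
    ∀ t ∈ Ico (0:ℝ) 1, Metric.diam (α '' Icc 0 t) ≤ L * infDist (α t) (frontier Ω)

/-- An `L`-John curve in `Ω` with tip `z` and base-point `∞`, parametrized on `[0,∞)`. -/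
def IsJohnCurveInfty (Ω : Set ℂ) (L : ℝ) (α : ℝ → ℂ) (z : ℂ) : Prop :=
  ContinuousOn α (Ici 0) ∧ InjOn α (Ici 0) ∧ α 0 = z ∧
    MapsTo α (Ici 0) Ω ∧ Tendsto α atTop (cobounded ℂ) ∧
    ∀ t ∈ Ici (0:ℝ), Metric.diam (α '' Icc 0 t) ≤ L * infDist (α t) (frontier Ω)

section Helpers

open MeasureTheory Topology
open scoped Real ENNReal


lemma aux_polar (a b : ℝ) (ha : 0 ≤ a) (F : ℂ → ℝ≥0∞) :
    ∫⁻ z in {z : ℂ | a < ‖z‖ ∧ ‖z‖ < b}, F z =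
      ∫⁻ p in Ioo a b ×ˢ Ioo (-π) π, ENNReal.ofReal p.1 * F (Complex.polarCoord.symm p) := by
  have hm : MeasurableSet {z : ℂ | a < ‖z‖ ∧ ‖z‖ < b} :=
    (measurableSet_lt measurable_const measurable_norm).inter
      (measurableSet_lt measurable_norm measurable_const)
  rw [← lintegral_indicator hm, ← Complex.lintegral_comp_polarCoord_symm]
  have h2 : MeasurableSet (Ioo a b ×ˢ Ioo (-π) π) := measurableSet_Ioo.prod measurableSet_Ioo
  have hT : MeasurableSet polarCoord.target := polarCoord.open_target.measurableSet
  rw [← lintegral_indicator hT, ← lintegral_indicator h2]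
  congr 1
  ext p
  by_cases hp : p ∈ polarCoord.target
  · rw [indicator_of_mem hp]
    have hp' := hp
    rw [polarCoord_target] at hp'
    have h1 : 0 < p.1 := hp'.1
    have hn : ‖Complex.polarCoord.symm p‖ = p.1 := by
      rw [Complex.norm_polarCoord_symm, abs_of_pos h1]
    by_cases hq : a < p.1 ∧ p.1 < b
    · rw [indicator_of_mem (by simpa [abs_of_pos h1] using hq), indicator_of_mem]
      · simp
      · exact ⟨hq, hp'.2⟩
    · rw [indicator_of_notMem (by simpa [abs_of_pos h1] using hq), indicator_of_notMem]
      · simp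
      · exact fun h => hq h.1
  · rw [indicator_of_notMem hp, indicator_of_notMem]
    rintro ⟨h1, h2⟩
    apply hp
    rw [polarCoord_target]
    exact ⟨lt_of_le_of_lt ha h1.1, h2⟩

lemma aux_upper (M q : ℝ) (hM : 0 < M) (hq : 0 < q) :
    ∫⁻ z in {z : ℂ | 0 < ‖z‖ ∧ ‖z‖ < M}, ENNReal.ofReal (‖z‖ ^ (2*q-2)) =
      ENNReal.ofReal (π * M ^ (2*q) / q) := by
  rw [aux_polar 0 M le_rfl]
  have h2 : MeasurableSet (Ioo 0 M ×ˢ Ioo (-π) π) := measurableSet_Ioo.prod measurableSet_Ioo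
  have e1 : ∫⁻ p in Ioo 0 M ×ˢ Ioo (-π) π, ENNReal.ofReal p.1 *
      ENNReal.ofReal (‖Complex.polarCoord.symm p‖ ^ (2*q-2)) =
      ∫⁻ p in Ioo 0 M ×ˢ Ioo (-π) π, ENNReal.ofReal (p.1 ^ (2*q-1)) := by
    refine setLIntegral_congr_fun h2 ?_
    rintro p ⟨h1, _⟩
    have h1' : 0 < p.1 := h1.1
    dsimp only
    rw [Complex.norm_polarCoord_symm, abs_of_pos h1', ← ENNReal.ofReal_mul h1'.le]
    congr 1
    nth_rewrite 1 [← Real.rpow_one p.1]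
    rw [← Real.rpow_add h1']
    congr 1; ring
  rw [e1, Measure.volume_eq_prod, ← Measure.prod_restrict, lintegral_prod]
  swap
  · fun_prop
  simp only [lintegral_const, Measure.restrict_apply_univ, Real.volume_Ioo, MeasurableSet.univ]
  rw [lintegral_mul_const _ (by fun_prop)]
  have hint : IntervalIntegrable (fun x : ℝ => x ^ (2*q-1)) volume 0 M :=
    intervalIntegral.intervalIntegrable_rpow' (by linarith)
  have : ∫⁻ x in Ioo 0 M, ENNReal.ofReal (x ^ (2*q-1)) = ENNReal.ofReal (M ^ (2*q) / (2*q)) := by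
    rw [← ofReal_integral_eq_lintegral_ofReal]
    · rw [← integral_Ioc_eq_integral_Ioo, ← intervalIntegral.integral_of_le hM.le,
        integral_rpow (by left; linarith)]
      rw [show 2*q-1+1 = 2*q by ring, Real.zero_rpow (by positivity), sub_zero]
    · exact (hint.1).mono_set Ioo_subset_Ioc_self
    · exact (ae_restrict_iff' measurableSet_Ioo).2
        (Eventually.of_forall fun x hx => Real.rpow_nonneg hx.1.le _)
  rw [this, ← ENNReal.ofReal_mul (by positivity)]
  congr 1
  field_simp
  ring

lemma aux_circle (N : ℂ → ℂ) (hN : DifferentiableOn ℂ N (ball 0 1)) (h0 : N 0 = 1)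
    (s : ℝ) (hs : 0 < s) (hs1 : s < 1) :
    ENNReal.ofReal (2 * π * (1 + ‖deriv N 0‖^2 * s^2)) ≤
      ∫⁻ θ in Ioo (-π) π, ENNReal.ofReal (‖N (Complex.polarCoord.symm (s, θ))‖^2) := by
  set m := dslope N 0 with hm
  have hmd : DifferentiableOn ℂ m (ball 0 1) :=
    (Complex.differentiableOn_dslope (ball_mem_nhds _ one_pos)).2 hN
  set n1 := deriv N 0 with hn1
  have hm0 : m 0 = n1 := dslope_same _ _
  have hNm : ∀ z, N z = 1 + z * m z := by
    intro z
    have := sub_smul_dslope N 0 z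
    simp only [sub_zero, smul_eq_mul, h0] at this
    rw [hm, this]; ring
  let Q : ℂ → ℂ := fun z => 1 + 2 * (z * m z) + 2 * s^2 * (starRingEnd ℂ n1) * m z - s^2 * (‖n1‖^2 : ℝ)
  have hsub : closedBall (0:ℂ) s ⊆ ball 0 1 := closedBall_subset_ball hs1
  have hQd : DifferentiableOn ℂ Q (ball 0 1) := by
    have : DifferentiableOn ℂ (fun z : ℂ => z) (ball 0 1) := differentiableOn_id
    have h3 := this.mul hmd
    exact (((h3.const_mul 2).const_add 1).add (hmd.const_mul _)).sub_const _
  have hQa : Real.circleAverage Q 0 s = Q 0 := by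
    apply DiffContOnCl.circleAverage
    rw [abs_of_pos hs]
    refine DifferentiableOn.diffContOnCl ?_
    rw [closure_ball _ hs.ne']
    exact hQd.mono hsub
  have hQ0 : (Q 0).re = 1 + ‖n1‖^2 * s^2 := by
    have : Q 0 = ((1 + ‖n1‖^2 * s^2 : ℝ) : ℂ) := by
      simp only [Q, hm0]
      have : (starRingEnd ℂ n1) * n1 = ((‖n1‖^2 : ℝ) : ℂ) := by
        rw [mul_comm, Complex.mul_conj, Complex.normSq_eq_norm_sq]
      rw [mul_assoc (2 * (s:ℂ)^2), this]; push_cast; ring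
    rw [this, Complex.ofReal_re]
  have hcm : ∀ θ : ℝ, Complex.polarCoord.symm (s, θ) = circleMap 0 s θ := by
    intro θ
    rw [Complex.polarCoord_symm_apply, circleMap, Complex.exp_mul_I]
    simp
  have hpt : ∀ z : ℂ, ‖z‖ = s → (Q z).re ≤ ‖N z‖^2 := by
    intro z hz
    have h1 : ‖N z‖^2 = 1 + 2 * (z * m z).re + s^2 * ‖m z‖^2 := by
      rw [hNm, ← hz, ← mul_pow, ← norm_mul, ← Complex.normSq_eq_norm_sq, ← Complex.normSq_eq_norm_sq,
        Complex.normSq_apply, Complex.normSq_apply]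
      simp only [Complex.add_re, Complex.add_im, Complex.one_re, Complex.one_im]; ring
    have h2 : (Q z).re = 1 + 2 * (z * m z).re + s^2 * (2 * ((starRingEnd ℂ n1) * m z).re - ‖n1‖^2) := by
      have : Q z = 1 + ((2:ℝ):ℂ) * (z * m z) + ((s^2 * 2 : ℝ) : ℂ) * ((starRingEnd ℂ n1) * m z) - ((s^2 * ‖n1‖^2 : ℝ) : ℂ) := by
        simp only [Q]; push_cast; ring
      rw [this]
      simp only [Complex.add_re, Complex.sub_re, Complex.re_ofReal_mul, Complex.ofReal_re, Complex.one_re]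
      ring
    have h3 : 2 * ((starRingEnd ℂ n1) * m z).re - ‖n1‖^2 ≤ ‖m z‖^2 := by
      rw [← Complex.normSq_eq_norm_sq, ← Complex.normSq_eq_norm_sq,
        Complex.normSq_apply, Complex.normSq_apply]
      simp only [Complex.mul_re, Complex.conj_re, Complex.conj_im]
      nlinarith [sq_nonneg (n1.re - (m z).re), sq_nonneg (n1.im - (m z).im)]
    rw [h1, h2]
    nlinarith [sq_nonneg s]
  have hcmn : ∀ θ : ℝ, ‖circleMap 0 s θ‖ = s := by
    intro θ; rw [norm_circleMap_zero, abs_of_pos hs]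
  have hcQ : Continuous fun θ : ℝ => Q (circleMap 0 s θ) :=
    hQd.continuousOn.comp_continuous (continuous_circleMap 0 s)
      (fun θ => by simpa [hcmn] using hs1)
  have hcN : Continuous fun θ : ℝ => N (circleMap 0 s θ) :=
    hN.continuousOn.comp_continuous (continuous_circleMap 0 s)
      (fun θ => by simpa [hcmn] using hs1)
  have hint : ∫ θ in (-π)..π, (Q (circleMap 0 s θ)).re = 2 * π * (1 + ‖n1‖^2 * s^2) := by
    have hper : Function.Periodic (fun θ : ℝ => Q (circleMap 0 s θ)) (2 * π) := by
      intro θ; simp only [periodic_circleMap 0 s θ]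
    have h1 : ∫ θ in (-π)..π, Q (circleMap 0 s θ) = ∫ θ in (0:ℝ)..2*π, Q (circleMap 0 s θ) := by
      have := hper.intervalIntegral_add_eq (-π) 0
      rw [show -π + 2 * π = π by ring, zero_add] at this
      exact this
    have h2 : ∫ θ in (-π)..π, Q (circleMap 0 s θ) = 2 * π * Q 0 := by
      rw [h1, ← hQa, Real.circleAverage]
      rw [Complex.real_smul]
      have : (π : ℂ) ≠ 0 := by exact_mod_cast Real.pi_ne_zero
      push_cast
      field_simp
    have h3 : ∫ θ in (-π)..π, (Q (circleMap 0 s θ)).re = (∫ θ in (-π)..π, Q (circleMap 0 s θ)).re := by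
      have := Complex.reCLM.intervalIntegral_comp_comm (hcQ.intervalIntegrable (μ := volume) (-π) π)
      simpa using this
    rw [h3, h2, ← hQ0]
    have : (2 * (π:ℂ) * Q 0) = ((2 * π : ℝ) : ℂ) * Q 0 := by push_cast; ring
    rw [this, Complex.re_ofReal_mul]
  simp only [hcm]
  rw [← ofReal_integral_eq_lintegral_ofReal]
  · rw [← integral_Ioc_eq_integral_Ioo, ← intervalIntegral.integral_of_le (by linarith [Real.pi_pos]), ← hint]
    apply ENNReal.ofReal_le_ofReal
    apply intervalIntegral.integral_mono_on (by linarith [Real.pi_pos])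
    · exact (Complex.continuous_re.comp hcQ).intervalIntegrable _ _
    · exact (hcN.norm.pow 2).intervalIntegrable _ _
    · intro θ _; exact hpt _ (hcmn θ)
  · exact ((hcN.norm.pow 2).integrableOn_Icc).mono_set Ioo_subset_Icc_self
  · exact Eventually.of_forall fun θ => by positivity

lemma aux_det (c : ℂ) :
    ((ContinuousLinearMap.toSpanSingleton ℂ c).restrictScalars ℝ).det = ‖c‖^2 := by
  have : ((ContinuousLinearMap.toSpanSingleton ℂ c).restrictScalars ℝ).det =
      LinearMap.det ((LinearMap.toSpanSingleton ℂ ℂ c).restrictScalars ℝ) := rfl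
  rw [this, LinearMap.det_restrictScalars]
  have h : LinearMap.det (LinearMap.toSpanSingleton ℂ ℂ c) = c := by
    simp
  rw [h, Algebra.norm_complex_apply, Complex.normSq_eq_norm_sq]

lemma aux_null : volume {z : ℂ | z.im = 0} = 0 := by
  have h := Measure.addHaar_submodule (volume : Measure ℂ) (LinearMap.ker Complex.imLm) (by
    intro h
    have : (I : ℂ) ∈ LinearMap.ker Complex.imLm := by rw [h]; trivial
    simp at this)
  convert h using 2
  ext z; simp

lemma aux_log (k : ℂ → ℂ) (hk : DifferentiableOn ℂ k (ball 0 1))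
    (hk0 : ∀ z ∈ ball (0:ℂ) 1, k z ≠ 0) (h1 : k 0 = 1) :
    ∃ L : ℂ → ℂ, L 0 = 0 ∧ (∀ z ∈ ball (0:ℂ) 1, HasDerivAt L (deriv k z / k z) z) ∧
      ∀ z ∈ ball (0:ℂ) 1, Complex.exp (L z) = k z := by
  have hl : DifferentiableOn ℂ (fun z => deriv k z / k z) (ball 0 1) :=
    (hk.deriv isOpen_ball).div hk hk0
  obtain ⟨L, hL0, hL⟩ := hl.isExactOn_ball.with_val_at 0 0
  refine ⟨L, hL0, hL, ?_⟩
  intro z hz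
  have hd : ∀ z ∈ ball (0:ℂ) 1, HasDerivAt (fun z => k z * Complex.exp (- L z)) 0 z := by
    intro z hz
    have h2 : HasDerivAt k (deriv k z) z := (hk.differentiableAt (isOpen_ball.mem_nhds hz)).hasDerivAt
    refine (h2.mul ((hL z hz).neg.cexp)).congr_deriv ?_
    have h3 : deriv k z / k z * k z = deriv k z := div_mul_cancel₀ _ (hk0 z hz)
    simp only [Pi.neg_apply]
    linear_combination -Complex.exp (- L z) * h3
  have hc : k z * Complex.exp (- L z) = k 0 * Complex.exp (- L 0) := by
    refine (convex_ball (0:ℂ) 1).is_const_of_fderivWithin_eq_zero (𝕜 := ℂ)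
      (f := fun z => k z * Complex.exp (- L z)) ?_ ?_ hz (by simp)
    · exact fun x hx => (hd x hx).differentiableAt.differentiableWithinAt
    · intro x hx
      rw [fderivWithin_of_isOpen isOpen_ball hx]
      ext
      simp [(hd x hx).deriv]
  rw [h1, hL0, Complex.exp_neg, neg_zero, Complex.exp_zero, one_mul] at hc
  have := Complex.exp_ne_zero (L z)
  field_simp at hc
  exact hc.symm

lemma aux_lower (N : ℂ → ℂ) (hN : DifferentiableOn ℂ N (ball 0 1)) (h0 : N 0 = 1)
    (ε ρ q : ℝ) (hε : 0 < ε) (hερ : ε < ρ) (hρ : ρ < 1) (hq : 0 < q) (hq1 : q < 1) :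
    ENNReal.ofReal (2 * π * ((ε^(-2*q) - ρ^(-2*q))/(2*q) +
      ‖deriv N 0‖^2 * ((ρ^(2-2*q) - ε^(2-2*q))/(2-2*q)))) ≤
    ∫⁻ z in {z : ℂ | ε < ‖z‖ ∧ ‖z‖ < ρ}, ENNReal.ofReal (‖z‖^(-2-2*q) * ‖N z‖^2) := by
  rw [aux_polar ε ρ hε.le]
  have hmS : MeasurableSet (Ioo ε ρ ×ˢ Ioo (-π) π) := measurableSet_Ioo.prod measurableSet_Ioo
  have hpos : ∀ p ∈ Ioo ε ρ ×ˢ Ioo (-π) π, 0 < p.1 := fun p hp => hε.trans hp.1.1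
  have e1 : ∫⁻ p in Ioo ε ρ ×ˢ Ioo (-π) π, ENNReal.ofReal p.1 *
      ENNReal.ofReal (‖Complex.polarCoord.symm p‖ ^ (-2-2*q) * ‖N (Complex.polarCoord.symm p)‖^2) =
      ∫⁻ p in Ioo ε ρ ×ˢ Ioo (-π) π,
        ENNReal.ofReal (p.1 ^ (-1-2*q)) * ENNReal.ofReal (‖N (Complex.polarCoord.symm p)‖^2) := by
    refine setLIntegral_congr_fun hmS ?_
    intro p hp
    have h1' := hpos p hp
    dsimp only
    rw [Complex.norm_polarCoord_symm, abs_of_pos h1', ← ENNReal.ofReal_mul h1'.le,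
      ← ENNReal.ofReal_mul (by positivity), ← mul_assoc]
    congr 2
    nth_rewrite 1 [← Real.rpow_one p.1]
    rw [← Real.rpow_add h1']
    congr 1; ring
  have hcp : Continuous (fun p : ℝ × ℝ => Complex.polarCoord.symm p) := by
    simp only [Complex.polarCoord_symm_apply]
    fun_prop
  have hcN : ContinuousOn (fun p : ℝ × ℝ => N (Complex.polarCoord.symm p)) (Ioo ε ρ ×ˢ Ioo (-π) π) := by
    refine hN.continuousOn.comp hcp.continuousOn ?_
    intro p hp
    rw [mem_ball_zero_iff, Complex.norm_polarCoord_symm, abs_of_pos (hpos p hp)]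
    exact hp.1.2.trans hρ
  rw [e1, Measure.volume_eq_prod, ← Measure.prod_restrict, lintegral_prod]
  swap
  · rw [Measure.prod_restrict, ← Measure.volume_eq_prod]
    refine AEMeasurable.mul (Measurable.aemeasurable (f := fun p : ℝ × ℝ => ENNReal.ofReal (p.1 ^ (-1-2*q))) (by fun_prop)) ?_
    exact (ENNReal.continuous_ofReal.comp_continuousOn (hcN.norm.pow 2)).aemeasurable hmS
  calc _ = ∫⁻ s in Ioo ε ρ, ENNReal.ofReal (s^(-1-2*q) * (2 * π * (1 + ‖deriv N 0‖^2 * s^2))) := by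
        have hpt : ∀ s ∈ Ioo ε ρ, s^(-1-2*q) * (2 * π * (1 + ‖deriv N 0‖^2 * s^2)) =
            2 * π * (s^(-1-2*q) + ‖deriv N 0‖^2 * s^(1-2*q)) := by
          intro s hs
          have : 0 < s := hε.trans hs.1
          have h3 : s^(1-2*q) = s^(-1-2*q) * s^2 := by
            rw [← Real.rpow_natCast s 2, ← Real.rpow_add this]; congr 1; push_cast; ring
          rw [h3]; ring
        have hnot : (0:ℝ) ∉ uIcc ε ρ := by
          rw [uIcc_of_le hερ.le]; exact fun h => absurd h.1 (not_le.2 hε)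
        have i1 : IntervalIntegrable (fun s : ℝ => s^(-1-2*q)) volume ε ρ :=
          intervalIntegral.intervalIntegrable_rpow (Or.inr hnot)
        have i2 : IntervalIntegrable (fun s : ℝ => s^(1-2*q)) volume ε ρ :=
          intervalIntegral.intervalIntegrable_rpow (Or.inr hnot)
        have i3 : IntervalIntegrable (fun s : ℝ => 2 * π * (s^(-1-2*q) + ‖deriv N 0‖^2 * s^(1-2*q))) volume ε ρ :=
          (i1.add (i2.const_mul _)).const_mul _
        have e2 : ∫⁻ s in Ioo ε ρ, ENNReal.ofReal (s^(-1-2*q) * (2 * π * (1 + ‖deriv N 0‖^2 * s^2))) =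
            ∫⁻ s in Ioo ε ρ, ENNReal.ofReal (2 * π * (s^(-1-2*q) + ‖deriv N 0‖^2 * s^(1-2*q))) :=
          setLIntegral_congr_fun measurableSet_Ioo fun s hs => by rw [hpt s hs]
        rw [e2, ← ofReal_integral_eq_lintegral_ofReal]
        · congr 1
          rw [← integral_Ioc_eq_integral_Ioo, ← intervalIntegral.integral_of_le hερ.le,
            intervalIntegral.integral_const_mul, intervalIntegral.integral_add i1 (i2.const_mul _),
            intervalIntegral.integral_const_mul,
            integral_rpow (Or.inr ⟨by linarith, hnot⟩), integral_rpow (Or.inl (by linarith))]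
          rw [show -1-2*q+1 = -2*q by ring, show 1-2*q+1 = 2-2*q by ring]
          congr 2
          rw [show -2*q = -(2*q) by ring, div_neg, ← neg_div, neg_sub]
        · exact i3.1.mono_set Ioo_subset_Ioc_self
        · refine (ae_restrict_iff' measurableSet_Ioo).2 (Eventually.of_forall fun s hs => ?_)
          have : 0 < s := hε.trans hs.1
          show (0:ℝ) ≤ 2 * π * (s^(-1-2*q) + ‖deriv N 0‖^2 * s^(1-2*q))
          positivity
    _ ≤ _ := by
        refine setLIntegral_mono' measurableSet_Ioo fun s hs => ?_
        have hs0 : 0 < s := hε.trans hs.1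
        rw [ENNReal.ofReal_mul (by positivity)]
        dsimp only
        rw [lintegral_const_mul' _ _ ENNReal.ofReal_ne_top]
        gcongr
        exact aux_circle N hN h0 s hs0 (hs.2.trans hρ)

lemma aux_area_ineq (k : ℂ → ℂ) (hk : DifferentiableOn ℂ k (ball 0 1))
    (hk0 : ∀ z ∈ ball (0:ℂ) 1, k z ≠ 0) (h1 : k 0 = 1)
    (hinj : InjOn (fun z => k z / z) {z : ℂ | z ∈ ball (0:ℂ) 1 ∧ z.im ≠ 0})
    (ε ρ q M : ℝ) (hε : 0 < ε) (hερ : ε < ρ) (hρ : ρ < 1) (hq : 0 < q) (hq1 : q < 1) (hM : 0 < M)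
    (hkM : ∀ z : ℂ, ε < ‖z‖ → ‖z‖ < ρ → z.im ≠ 0 → ‖k z / z‖ < M) :
    (ε^(-2*q) - ρ^(-2*q))/q + (1-q) * ‖deriv k 0‖^2 * (ρ^(2-2*q) - ε^(2-2*q)) ≤ M^(2*q)/q := by
  obtain ⟨L, hL0, hL, hexp⟩ := aux_log k hk hk0 h1
  have hkd : ∀ z ∈ ball (0:ℂ) 1, HasDerivAt k (deriv k z) z := fun z hz =>
    (hk.differentiableAt (isOpen_ball.mem_nhds hz)).hasDerivAt
  set l : ℂ → ℂ := fun z => deriv k z / k z with hl_def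
  have hl : DifferentiableOn ℂ l (ball 0 1) := (hk.deriv isOpen_ball).div hk hk0
  let N : ℂ → ℂ := fun z => Complex.exp (q * L z) * (1 - z * l z)
  have hLd : DifferentiableOn ℂ L (ball 0 1) := fun z hz =>
    (hL z hz).differentiableAt.differentiableWithinAt
  have hNd : DifferentiableOn ℂ N (ball 0 1) :=
    (hLd.const_mul _).cexp.mul ((differentiableOn_id.mul hl).const_sub 1)
  have hN0 : N 0 = 1 := by simp [N, hL0]
  have h00 : (0:ℂ) ∈ ball (0:ℂ) 1 := by simp
  have hl0 : l 0 = deriv k 0 := by simp [hl_def, h1]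
  have hNder : deriv N 0 = (q - 1) * deriv k 0 := by
    have hld := (hl.differentiableAt (isOpen_ball.mem_nhds h00)).hasDerivAt
    have := (((hL 0 h00).const_mul (q:ℂ)).cexp).mul (((hasDerivAt_id (0:ℂ)).mul hld).const_sub 1)
    have h2 : deriv N 0 = _ := this.deriv
    rw [h2]
    simp [hL0, h1, hl0]
    ring
  have hNder' : ‖deriv N 0‖^2 = (1-q)^2 * ‖deriv k 0‖^2 := by
    rw [hNder, norm_mul, mul_pow]
    congr 2
    rw [← Complex.ofReal_one, ← Complex.ofReal_sub, Complex.norm_real, Real.norm_eq_abs,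
      abs_of_neg (by linarith)]
    ring
  have hlow := aux_lower N hNd hN0 ε ρ q hε hερ hρ hq hq1
  set S : Set ℂ := {z : ℂ | (ε < ‖z‖ ∧ ‖z‖ < ρ) ∧ z.im ≠ 0} with hS
  have hmA : MeasurableSet {z : ℂ | ε < ‖z‖ ∧ ‖z‖ < ρ} :=
    (measurableSet_lt measurable_const measurable_norm).inter
      (measurableSet_lt measurable_norm measurable_const)
  have hmS : MeasurableSet S :=
    hmA.inter (measurableSet_eq_fun Complex.measurable_im measurable_const).compl
  have hae : ({z : ℂ | ε < ‖z‖ ∧ ‖z‖ < ρ} : Set ℂ) =ᵐ[volume] S := by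
    have h : ∀ᵐ z : ℂ, z.im ≠ 0 := by
      rw [ae_iff]; simpa using aux_null
    filter_upwards [h] with z hz
    apply propext
    exact ⟨fun h => ⟨h, hz⟩, fun h => h.1⟩
  have hSb : ∀ z ∈ S, z ∈ ball (0:ℂ) 1 ∧ z ≠ 0 := fun z hz =>
    ⟨by rw [mem_ball_zero_iff]; exact hz.1.2.trans hρ, by
      rw [← norm_pos_iff]; exact hε.trans hz.1.1⟩
  have hPd : ∀ z ∈ S, HasDerivAt (fun z => k z / z) ((deriv k z * z - k z * 1) / z^2) z := fun z hz =>
    (hkd z (hSb z hz).1).div (hasDerivAt_id z) (hSb z hz).2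
  have hcov := lintegral_image_eq_lintegral_abs_det_fderiv_mul (volume : Measure ℂ) hmS
    (f := fun z => k z / z)
    (f' := fun z => (ContinuousLinearMap.toSpanSingleton ℂ ((deriv k z * z - k z * 1) / z^2)).restrictScalars ℝ)
    (fun z hz => ((hPd z hz).hasFDerivAt.restrictScalars ℝ).hasFDerivWithinAt)
    (hinj.mono (fun z hz => ⟨(hSb z hz).1, hz.2⟩ : S ⊆ {z : ℂ | z ∈ ball (0:ℂ) 1 ∧ z.im ≠ 0})) (fun w => ENNReal.ofReal (‖w‖ ^ (2*q-2)))
  have himg : (fun z => k z / z) '' S ⊆ {z : ℂ | 0 < ‖z‖ ∧ ‖z‖ < M} := by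
    rintro _ ⟨z, hz, rfl⟩
    exact ⟨norm_pos_iff.2 (div_ne_zero (hk0 z (hSb z hz).1) (hSb z hz).2), hkM z hz.1.1 hz.1.2 hz.2⟩
  have hup := (lintegral_mono_set (μ := volume) (f := fun w : ℂ => ENNReal.ofReal (‖w‖ ^ (2*q-2))) himg).trans_eq
    (aux_upper M q hM hq)
  rw [hcov] at hup
  have heq : ∫⁻ z in S, ENNReal.ofReal |((ContinuousLinearMap.toSpanSingleton ℂ ((deriv k z * z - k z * 1) / z^2)).restrictScalars ℝ).det| *
      ENNReal.ofReal (‖k z / z‖ ^ (2*q-2)) =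
      ∫⁻ z in S, ENNReal.ofReal (‖z‖^(-2-2*q) * ‖N z‖^2) := by
    refine setLIntegral_congr_fun hmS fun z hz => ?_
    obtain ⟨hzb, hz0⟩ := hSb z hz
    rw [aux_det, abs_of_nonneg (by positivity), ← ENNReal.ofReal_mul (by positivity)]
    congr 1
    have hkz := hk0 z hzb
    have hzp : 0 < ‖z‖ := norm_pos_iff.2 hz0
    have hkp : 0 < ‖k z‖ := norm_pos_iff.2 hkz
    have a1 : ‖Complex.exp (q * L z)‖ = ‖k z‖ ^ q := by
      rw [← hexp z hzb, Complex.norm_exp, Complex.norm_exp, ← Real.exp_mul, Complex.re_ofReal_mul, mul_comm]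
    have a2 : (deriv k z * z - k z * 1) / z^2 = - (k z * (1 - z * l z)) / z^2 := by
      simp only [hl_def]; field_simp; ring
    rw [a2]
    simp only [N]
    rw [norm_mul, a1, norm_div, norm_div, norm_neg, norm_mul, norm_pow, Real.div_rpow hkp.le hzp.le]
    have b1 : ‖k z‖ ^ (2*q-2) = (‖k z‖^q)^2 / ‖k z‖^2 := by
      rw [Real.rpow_sub hkp, mul_comm 2 q, Real.rpow_mul hkp.le, Real.rpow_two, Real.rpow_two]
    have b2 : ‖z‖ ^ (2*q-2) = (‖z‖^q)^2 / ‖z‖^2 := by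
      rw [Real.rpow_sub hzp, mul_comm 2 q, Real.rpow_mul hzp.le, Real.rpow_two, Real.rpow_two]
    have b3 : ‖z‖ ^ (-2-2*q) = 1 / (‖z‖^2 * (‖z‖^q)^2) := by
      rw [show -2-2*q = -(2 + q*2) by ring, Real.rpow_neg hzp.le, Real.rpow_add hzp,
        Real.rpow_mul hzp.le, Real.rpow_two, Real.rpow_two, one_div]
    rw [b1, b2, b3]
    have : 0 < ‖z‖^q := by positivity
    field_simp
  rw [heq, ← setLIntegral_congr hae] at hup
  have hfin := hlow.trans hup
  rw [ENNReal.ofReal_le_ofReal_iff (by positivity), hNder'] at hfin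
  have hpi := Real.pi_pos
  have h1q : 0 < 1 - q := by linarith
  have e1 : 2 * π * ((ε^(-2*q) - ρ^(-2*q))/(2*q) +
      (1-q)^2 * ‖deriv k 0‖^2 * ((ρ^(2-2*q) - ε^(2-2*q))/(2-2*q))) =
      π * ((ε^(-2*q) - ρ^(-2*q))/q + (1-q) * ‖deriv k 0‖^2 * (ρ^(2-2*q) - ε^(2-2*q))) := by
    rw [show 2 - 2*q = 2*(1-q) by ring]
    field_simp
  rw [e1, mul_div_assoc] at hfin
  exact le_of_mul_le_mul_left hfin hpi

lemma aux_area (k : ℂ → ℂ) (hk : DifferentiableOn ℂ k (ball 0 1))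
    (hk0 : ∀ z ∈ ball (0:ℂ) 1, k z ≠ 0) (h1 : k 0 = 1)
    (hinj : InjOn (fun z => k z / z) {z : ℂ | z ∈ ball (0:ℂ) 1 ∧ z.im ≠ 0})
    (C ε₀ : ℝ) (hC : 0 < C) (hε₀ : 0 < ε₀)
    (hkM : ∀ ε, 0 < ε → ε < ε₀ → ∀ z ∈ ball (0:ℂ) 1, ε < ‖z‖ → z.im ≠ 0 → ‖k z / z‖ < ε⁻¹ + C) :
    ‖deriv k 0‖ ≤ 2 := by
  set A := ‖deriv k 0‖^2 with hA
  -- step 1 : let ε → 0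
  have s1 : ∀ q ρ : ℝ, 0 < q → q < 1/2 → 0 < ρ → ρ < 1 →
      (1-q) * A * ρ^(2-2*q) ≤ ρ^(-2*q)/q := by
    intro q ρ hq hq2 hρ hρ1
    have hev : ∀ᶠ ε : ℝ in 𝓝[>] 0, (1-q) * A * (ρ^(2-2*q) - ε^(2-2*q)) ≤
        ρ^(-2*q)/q + 2 * C * ε^(1-2*q) := by
      have hlt : ∀ᶠ ε : ℝ in 𝓝[>] 0, ε < ε₀ ∧ ε < ρ :=
        ((eventually_lt_nhds hε₀).and (eventually_lt_nhds hρ)).filter_mono nhdsWithin_le_nhds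
      filter_upwards [hlt, self_mem_nhdsWithin] with ε h2 h3
      have h3 : 0 < ε := h3
      have := aux_area_ineq k hk hk0 h1 hinj ε ρ q (ε⁻¹ + C) h3 h2.2 hρ1 hq (by linarith)
        (by positivity) (fun z hz hz' hzi => hkM ε h3 h2.1 z (by
          rw [mem_ball_zero_iff]; exact hz'.trans hρ1) hz hzi)
      rw [← hA] at this
      have hb : (ε⁻¹ + C)^(2*q) ≤ ε^(-2*q) + 2 * q * C * ε^(1-2*q) := by
        have e1 : ε⁻¹ + C = ε⁻¹ * (1 + C * ε) := by field_simp
        have e2 := rpow_one_add_le_one_add_mul_self (s := C * ε) (by nlinarith [mul_pos hC h3]) (p := 2*q)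
          (by linarith) (by linarith)
        have e3 : (ε⁻¹)^(2*q) = ε^(-2*q) := by
          rw [Real.inv_rpow h3.le, ← Real.rpow_neg h3.le]; congr 1; ring
        have e4 : ε^(1-2*q) = ε^(-2*q) * ε := by
          rw [show 1-2*q = -2*q+1 by ring, Real.rpow_add h3, Real.rpow_one]
        rw [e1, Real.mul_rpow (by positivity) (by positivity), e3, e4]
        have : 0 < ε^(-2*q) := by positivity
        nlinarith
      have hb' : (ε⁻¹ + C)^(2*q)/q ≤ ε^(-2*q)/q + 2 * C * ε^(1-2*q) := by
        rw [div_le_iff₀ hq, add_mul, div_mul_cancel₀ _ hq.ne']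
        linarith
      rw [sub_div] at this
      linarith
    have t0 : ∀ a : ℝ, 0 < a → Tendsto (fun ε : ℝ => ε^a) (𝓝[>] 0) (𝓝 0) := by
      intro a ha
      have := (Real.continuousAt_rpow_const 0 a (Or.inr ha.le)).tendsto
      rw [Real.zero_rpow ha.ne'] at this
      exact this.mono_left nhdsWithin_le_nhds
    have t1 : Tendsto (fun ε : ℝ => (1-q) * A * (ρ^(2-2*q) - ε^(2-2*q))) (𝓝[>] 0)
        (𝓝 ((1-q) * A * (ρ^(2-2*q) - 0))) := ((t0 _ (by linarith)).const_sub _).const_mul _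
    have t2 : Tendsto (fun ε : ℝ => ρ^(-2*q)/q + 2 * C * ε^(1-2*q)) (𝓝[>] 0)
        (𝓝 (ρ^(-2*q)/q + 2 * C * 0)) := ((t0 _ (by linarith)).const_mul _).const_add _
    have := le_of_tendsto_of_tendsto t1 t2 hev
    simpa using this
  have s2 : ∀ q : ℝ, 0 < q → q < 1/2 → (1-q) * A ≤ 1/q := by
    intro q hq hq2
    have hev : ∀ᶠ ρ : ℝ in 𝓝[<] 1, (1-q) * A * ρ^(2-2*q) ≤ ρ^(-2*q)/q := by
      filter_upwards [self_mem_nhdsWithin,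
        (eventually_gt_nhds (zero_lt_one (α := ℝ))).filter_mono nhdsWithin_le_nhds] with ρ h2 h3
      exact s1 q ρ hq hq2 h3 h2
    have t0 : ∀ a : ℝ, Tendsto (fun ε : ℝ => ε^a) (𝓝[<] 1) (𝓝 1) := by
      intro a
      have := (Real.continuousAt_rpow_const 1 a (Or.inl one_ne_zero)).tendsto
      rw [Real.one_rpow] at this
      exact this.mono_left nhdsWithin_le_nhds
    have := le_of_tendsto_of_tendsto ((t0 (2-2*q)).const_mul ((1-q)*A)) ((t0 (-2*q)).div_const q) hev
    simpa using this
  have s3 : (1 - 1/2) * A ≤ 1/(1/2 : ℝ) := by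
    have hev : ∀ᶠ q : ℝ in 𝓝[<] (1/2), (1-q) * A ≤ 1/q := by
      filter_upwards [self_mem_nhdsWithin,
        (eventually_gt_nhds (show (0:ℝ) < 1/2 by norm_num)).filter_mono nhdsWithin_le_nhds] with ρ h2 h3
      exact s2 ρ h3 h2
    have t1 : Tendsto (fun q : ℝ => (1-q) * A) (𝓝[<] (1/2)) (𝓝 ((1-1/2)*A)) :=
      (Continuous.tendsto (by fun_prop) (1/2)).mono_left nhdsWithin_le_nhds
    have t2 : Tendsto (fun q : ℝ => 1/q) (𝓝[<] (1/2)) (𝓝 (1/(1/2 : ℝ))) :=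
      (ContinuousAt.tendsto (by
        apply ContinuousAt.div continuousAt_const continuousAt_id; norm_num)).mono_left nhdsWithin_le_nhds
    exact le_of_tendsto_of_tendsto t1 t2 hev
  norm_num at s3
  have : ‖deriv k 0‖^2 ≤ 2^2 := by rw [← hA]; linarith
  exact le_of_sq_le_sq this (by norm_num)

lemma aux_open {U : Set ℂ} (hU : IsOpen U) {f : ℂ → ℂ} (hf : DifferentiableOn ℂ f U)
    (hinj : InjOn f U) {z₀ : ℂ} (hz : z₀ ∈ U) : 𝓝 (f z₀) ≤ map f (𝓝 z₀) := by
  have ha : AnalyticAt ℂ f z₀ := (hf.analyticOnNhd hU) z₀ hz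
  rcases ha.eventually_constant_or_nhds_le_map_nhds with h | h
  · exfalso
    have h2 : ∀ᶠ z in 𝓝[≠] z₀, z = z₀ := by
      have := h.and (hU.mem_nhds hz)
      filter_upwards [this.filter_mono nhdsWithin_le_nhds] with z hz'
      exact hinj hz'.2 hz hz'.1
    have h3 : ∀ᶠ z in 𝓝[≠] z₀, z ≠ z₀ := self_mem_nhdsWithin
    obtain ⟨z, h4, h5⟩ := (h2.and h3).exists
    exact h5 h4
  · exact h

lemma aux_inv {U : Set ℂ} (hU : IsOpen U) {f g : ℂ → ℂ} (hf : DifferentiableOn ℂ f U)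
    (hinj : InjOn f U) (hg : ∀ z ∈ U, g (f z) = z) {z₀ : ℂ} (hz : z₀ ∈ U) :
    DifferentiableAt ℂ g (f z₀) := by
  have hcont : ∀ z ∈ U, ContinuousAt g (f z) := by
    intro z hz
    have h1 : Tendsto g (map f (𝓝 z)) (𝓝 z) := by
      rw [tendsto_map'_iff]
      refine Tendsto.congr' ?_ tendsto_id
      filter_upwards [hU.mem_nhds hz] with w hw
      simp [hg w hw]
    have := h1.mono_left (aux_open hU hf hinj hz)
    rwa [ContinuousAt, hg z hz]
  have hev : ∀ z ∈ U, ∀ᶠ y in 𝓝 (f z), y ∈ f '' U := by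
    intro z hz
    apply aux_open hU hf hinj hz
    rw [mem_map]
    filter_upwards [hU.mem_nhds hz] with w hw
    exact ⟨w, hw, rfl⟩
  have ha : AnalyticAt ℂ f z₀ := (hf.analyticOnNhd hU) z₀ hz
  have hd : ∀ᶠ z in 𝓝[≠] z₀, deriv f z ≠ 0 := by
    rcases ha.deriv.eventually_eq_zero_or_eventually_ne_zero with h | h
    · exfalso
      have := h.and (hU.mem_nhds hz)
      obtain ⟨r, hr, hb⟩ := Metric.eventually_nhds_iff_ball.1 this
      have hc : ∀ z ∈ ball z₀ r, f z = f z₀ := by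
        intro z hz'
        refine (isOpen_ball.is_const_of_deriv_eq_zero (convex_ball z₀ r).isPreconnected
          (hf.mono fun w hw => (hb w hw).2) (fun w hw => (hb w hw).1) hz' (mem_ball_self hr))
      have h4 : z₀ + (r/2 : ℝ) ∈ ball z₀ r := by
        simp only [mem_ball, dist_eq_norm, add_sub_cancel_left, norm_real, Real.norm_eq_abs]
        rw [abs_of_pos (by linarith)]; linarith
      have h5 := hinj (hb _ h4).2 hz (hc _ h4)
      have : ((r/2 : ℝ) : ℂ) = 0 := by simpa using h5
      have : r/2 = 0 := by exact_mod_cast this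
      linarith
    · exact h
  have hgc := hcont z₀ hz
  refine (Complex.analyticAt_of_differentiable_on_punctured_nhds_of_continuousAt ?_
    hgc).differentiableAt
  have h1 : Tendsto g (𝓝[≠] (f z₀)) (𝓝[≠] z₀) := by
    refine tendsto_nhdsWithin_iff.2 ⟨?_, ?_⟩
    · have : Tendsto g (𝓝 (f z₀)) (𝓝 (g (f z₀))) := hgc
      rw [hg z₀ hz] at this
      exact this.mono_left nhdsWithin_le_nhds
    · filter_upwards [(hev z₀ hz).filter_mono nhdsWithin_le_nhds, self_mem_nhdsWithin] with y hy hy2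
      obtain ⟨w, hw, rfl⟩ := hy
      rw [hg w hw]
      rintro rfl
      exact hy2 rfl
  filter_upwards [h1.eventually hd, (hev z₀ hz).filter_mono nhdsWithin_le_nhds] with y hy hy2
  obtain ⟨w, hw, rfl⟩ := hy2
  have hfd : DifferentiableAt ℂ f w := hf.differentiableAt (hU.mem_nhds hw)
  have hfd2 : HasDerivAt f (deriv f w) (g (f w)) := by rw [hg w hw]; exact hfd.hasDerivAt
  rw [hg w hw] at hy
  refine (HasDerivAt.of_local_left_inverse (hcont w hw) hfd2 hy ?_).differentiableAt
  filter_upwards [hev w hw] with y hy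
  obtain ⟨v, hv, rfl⟩ := hy
  rw [hg v hv]

lemma aux_isOpenUHP : IsOpen {z : ℂ | 0 < z.im} := isOpen_lt continuous_const continuous_im

/-- `Im f ≥ Im` for hydrodynamically normalised maps. -/
lemma aux_im {f : ℂ → ℂ} (hf : DifferentiableOn ℂ f {z : ℂ | 0 < z.im})
    (hmaps : ∀ z : ℂ, 0 < z.im → 0 < (f z).im)
    (hlim : ∀ ε > 0, ∃ R : ℝ, ∀ z : ℂ, 0 < z.im → R ≤ ‖z‖ → ‖f z - z‖ < ε)
    (w : ℂ) (hw : 0 < w.im) : w.im ≤ (f w).im := by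
  refine le_of_forall_pos_le_add fun ε hε => ?_
  by_cases hεw : w.im ≤ ε
  · linarith [hmaps w hw]
  push Not at hεw
  obtain ⟨R, hR⟩ := hlim ε hε
  set M := max R 0 + ‖w‖ + 1
  set U : Set ℂ := {z | ε < z.im} ∩ ball 0 M
  have hUb : IsBounded U := isBounded_ball.subset inter_subset_right
  have hcl : closure U ⊆ {z | ε ≤ z.im} ∩ closedBall 0 M := by
    refine closure_minimal ?_ ((isClosed_le continuous_const continuous_im).inter isClosed_closedBall)
    rintro z ⟨h1, h2⟩
    exact ⟨(show ε < z.im from h1).le, ball_subset_closedBall h2⟩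
  have hsub : closure U ⊆ {z : ℂ | 0 < z.im} := fun z hz => lt_of_lt_of_le hε (hcl hz).1
  have hUo : IsOpen U := (isOpen_lt continuous_const continuous_im).inter isOpen_ball
  have hd : DiffContOnCl ℂ (fun z => cexp (I * (f z - z))) U := by
    apply DifferentiableOn.diffContOnCl
    refine DifferentiableOn.cexp ?_
    exact ((hf.mono hsub).sub differentiableOn_id).const_mul I
  have hnorm : ∀ z, ‖cexp (I * (f z - z))‖ = Real.exp (z.im - (f z).im) := by
    intro z; rw [Complex.norm_exp]; simp
  have hwU : w ∈ U := ⟨hεw, by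
    simp only [mem_ball, dist_zero_right, M]
    linarith [le_max_right R 0]⟩
  have key := Complex.norm_le_of_forall_mem_frontier_norm_le (C := Real.exp ε) hUb hd ?_
    (subset_closure hwU)
  · rw [hnorm, Real.exp_le_exp] at key
    linarith
  · intro z hz
    rw [hnorm, Real.exp_le_exp]
    have hzc := hcl hz.1
    have hz0 : 0 < z.im := hsub hz.1
    have hzn : z ∉ U := by
      have := hz.2; rwa [hUo.interior_eq] at this
    by_cases h : z.im = ε
    · linarith [hmaps z hz0]
    · have h1 : ε < z.im := lt_of_le_of_ne hzc.1 (Ne.symm h)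
      have h2 : M ≤ ‖z‖ := by
        by_contra h3
        exact hzn ⟨h1, by simpa using h3⟩
      have h3 := hR z hz0 (by
        have : R ≤ M := by
          simp only [M]; linarith [le_max_left R 0, norm_nonneg w]
        linarith)
      have h4 := (abs_im_le_norm (f z - z)).trans h3.le
      rw [sub_im, abs_le] at h4
      linarith [h4.1]

lemma aux_conn (R : ℝ) (hR : 0 < R) : IsPreconnected {z : ℂ | 0 < z.im ∧ R < ‖z‖} := by
  have h1 : {z : ℂ | 0 < z.im ∧ R < ‖z‖} = cexp '' ((Ioi (Real.log R)) ×ℂ (Ioo 0 π)) := by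
    ext z
    constructor
    · rintro ⟨h1, h2⟩
      have hz : z ≠ 0 := by rintro rfl; simp at h1
      refine ⟨Complex.log z, ?_, Complex.exp_log hz⟩
      rw [mem_reProdIm, Complex.log_re, Complex.log_im]
      refine ⟨Real.log_lt_log hR h2, ?_, ?_⟩
      · refine lt_of_le_of_ne (Complex.arg_nonneg_iff.2 h1.le) ?_
        intro h
        have := (Complex.arg_eq_zero_iff.1 h.symm).2
        linarith
      · refine lt_of_le_of_ne (Complex.arg_le_pi z) ?_
        intro h
        have := (Complex.arg_eq_pi_iff.1 h).2
        linarith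
    · rintro ⟨w, hw, rfl⟩
      rw [mem_reProdIm] at hw
      refine ⟨?_, ?_⟩
      · rw [Complex.exp_im]
        exact mul_pos (Real.exp_pos _) (Real.sin_pos_of_mem_Ioo hw.2)
      · rw [Complex.norm_exp]
        exact (Real.log_lt_iff_lt_exp hR).1 hw.1
  rw [h1]
  refine IsPreconnected.image ?_ _ Complex.continuous_exp.continuousOn
  exact (((convex_Ioi _).linear_preimage reLm).inter
    ((convex_Ioo _ _).linear_preimage imLm)).isPreconnected

lemma aux_inf {f g : ℂ → ℂ} 
    (hgc : ContinuousOn g {z : ℂ | 0 < z.im ∧ 1 < ‖z‖})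
    (hgf : ∀ z : ℂ, 0 < z.im → g (f z) = z)
    (hmaps : ∀ z : ℂ, 0 < z.im → 0 < (f z).im)
    (hg : ∀ z : ℂ, 0 < z.im → 1 < ‖z‖ → 0 < (g z).im ∧ f (g z) = z)
    (hlim : ∀ ε > 0, ∃ R : ℝ, ∀ z : ℂ, 0 < z.im → R ≤ ‖z‖ → ‖f z - z‖ < ε) :
    (∀ ε > 0, ∃ R : ℝ, ∀ z : ℂ, 0 < z.im → R < ‖z‖ → ‖g z - z‖ < ε) := by
  intro ε hε
  obtain ⟨R', hR'⟩ := hlim (min ε 1) (by positivity)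
  set R := max R' 1
  have hR1 : 1 ≤ R := le_max_right _ _
  have hR : ∀ z : ℂ, 0 < z.im → R ≤ ‖z‖ → ‖f z - z‖ < min ε 1 := fun z h1 h2 =>
    hR' z h1 ((le_max_left _ _).trans h2)
  refine ⟨R + 3, fun z hz1 hz2 => ?_⟩
  have hbig : R + 1 < ‖g z‖ := by
    by_contra hcon
    push Not at hcon
    have hV := aux_conn (R + 3) (by linarith)
    set w₁ : ℂ := ((R + 10 : ℝ) : ℂ) * I
    have hw1 : 0 < w₁.im := by simp [w₁]; linarith
    have hw2 : ‖w₁‖ = R + 10 := by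
      simp only [w₁, norm_mul, norm_I, mul_one, norm_real, Real.norm_eq_abs]
      rw [abs_of_pos (by linarith)]
    have h3 := hR w₁ hw1 (by linarith)
    have h4 : ‖w₁‖ ≤ ‖f w₁‖ + ‖f w₁ - w₁‖ := by
      have := norm_sub_le (f w₁) (f w₁ - w₁)
      simpa using this
    have h5 := min_le_right ε 1
    have hz1V : f w₁ ∈ {z : ℂ | 0 < z.im ∧ R + 3 < ‖z‖} := ⟨hmaps _ hw1, by linarith⟩
    have hzV : z ∈ {z : ℂ | 0 < z.im ∧ R + 3 < ‖z‖} := ⟨hz1, hz2⟩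
    have hc : ContinuousOn (fun z => ‖g z‖) {z : ℂ | 0 < z.im ∧ R + 3 < ‖z‖} :=
      (hgc.mono fun z hz => ⟨hz.1, by linarith [hz.2]⟩).norm
    have := hV.intermediate_value hzV hz1V hc
    obtain ⟨v, hv, hv2⟩ := this ⟨hcon, by
      show R + 1 ≤ ‖g (f w₁)‖
      rw [hgf _ hw1]; linarith⟩
    obtain ⟨hv3, hv4⟩ := hg v hv.1 (by linarith [hv.2])
    simp only at hv2
    have h6 := hR (g v) hv3 (by linarith)
    rw [hv4] at h6
    have h7 : ‖v‖ ≤ ‖g v‖ + ‖v - g v‖ := by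
      have := norm_add_le (g v) (v - g v)
      simpa using this
    linarith [hv.2]
  obtain ⟨h1, h2⟩ := hg z hz1 (by linarith)
  have h3 := hR (g z) h1 (by linarith)
  rw [h2] at h3
  rw [norm_sub_rev]
  exact h3.trans_le (min_le_left _ _)

lemma aux_rect {h : ℂ → ℂ} {U : Set ℂ} (hc : ContinuousOn h U)
    (hd : ∀ z ∈ U, z.im ≠ 0 → DifferentiableAt ℂ h z) (z w : ℂ) (hzw : Rectangle z w ⊆ U)
    (h0 : (0:ℝ) ∉ Ioo (min z.im w.im) (max z.im w.im)) :
    (∫ x : ℝ in z.re..w.re, h (x + z.im * I)) - (∫ x : ℝ in z.re..w.re, h (x + w.im * I)) +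
      I • (∫ y : ℝ in z.im..w.im, h (re w + y * I)) -
      I • (∫ y : ℝ in z.im..w.im, h (re z + y * I)) = 0 := by
  apply integral_boundary_rect_eq_zero_of_continuousOn_of_differentiableOn h z w (hc.mono hzw)
  intro v hv
  rw [mem_reProdIm] at hv
  refine (hd v (hzw ?_) ?_).differentiableWithinAt
  · rw [Rectangle, mem_reProdIm]
    exact ⟨Ioo_subset_Icc_self hv.1, Ioo_subset_Icc_self hv.2⟩
  · intro h; rw [h] at hv; exact h0 hv.2

lemma aux_painleve {h : ℂ → ℂ} {U : Set ℂ} (hU : IsOpen U) (hc : ContinuousOn h U)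
    (hd : ∀ z ∈ U, z.im ≠ 0 → DifferentiableAt ℂ h z) : DifferentiableOn ℂ h U := by
  rw [← isConservativeOn_and_continuousOn_iff_isDifferentiableOn hU]
  refine ⟨?_, hc⟩
  intro z w hzw
  rw [← add_eq_zero_iff_eq_neg, wedgeIntegral_add_wedgeIntegral_eq]
  by_cases h0 : (0:ℝ) ∈ uIcc z.im w.im
  · have hs1 : Rectangle z (w.re : ℂ) ⊆ U := by
      refine Subset.trans ?_ hzw
      intro v hv
      simp only [Rectangle, mem_reProdIm, ofReal_re, ofReal_im] at hv ⊢
      exact ⟨hv.1, uIcc_subset_uIcc left_mem_uIcc h0 hv.2⟩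
    have hs2 : Rectangle (z.re : ℂ) w ⊆ U := by
      refine Subset.trans ?_ hzw
      intro v hv
      simp only [Rectangle, mem_reProdIm, ofReal_re, ofReal_im] at hv ⊢
      exact ⟨hv.1, uIcc_subset_uIcc h0 right_mem_uIcc hv.2⟩
    have e1 := aux_rect hc hd z (w.re : ℂ) hs1 (by
      rintro ⟨h1, h2⟩
      simp only [ofReal_im, lt_sup_iff, inf_lt_iff, lt_irrefl, or_false] at h1 h2
      linarith)
    have e2 := aux_rect hc hd (z.re : ℂ) w hs2 (by
      rintro ⟨h1, h2⟩
      simp only [ofReal_im, lt_sup_iff, inf_lt_iff, lt_irrefl, false_or] at h1 h2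
      linarith)
    simp only [ofReal_re, ofReal_im] at e1 e2
    have hci : ∀ a : ℝ, a ∈ uIcc z.re w.re → ContinuousOn (fun y : ℝ => h (a + y * I)) (uIcc z.im w.im) := by
      intro a ha
      refine (hc.mono hzw).comp (by fun_prop) ?_
      intro y hy
      rw [Rectangle, mem_reProdIm]
      simpa using ⟨ha, hy⟩
    have hint : ∀ a : ℝ, a ∈ uIcc z.re w.re → (∫ y : ℝ in z.im..w.im, h (a + y * I)) =
        (∫ y : ℝ in z.im..0, h (a + y * I)) + ∫ y : ℝ in (0:ℝ)..w.im, h (a + y * I) := by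
      intro a ha
      rw [intervalIntegral.integral_add_adjacent_intervals]
      · exact ((hci a ha).mono (uIcc_subset_uIcc left_mem_uIcc h0)).intervalIntegrable
      · exact ((hci a ha).mono (uIcc_subset_uIcc h0 right_mem_uIcc)).intervalIntegrable
    rw [hint _ left_mem_uIcc, hint _ right_mem_uIcc]
    simp only [smul_eq_mul] at e1 e2 ⊢
    linear_combination e1 + e2
  · exact aux_rect hc hd z w hzw fun h => h0 (Ioo_subset_Icc_self h)

lemma aux_dense : {z : ℂ | 1 < ‖z‖} ⊆ closure {z : ℂ | 1 < ‖z‖ ∧ z.im ≠ 0} := by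
  have h1 : Dense {z : ℂ | z.im ≠ 0} := (dense_compl_singleton (0:ℝ)).preimage isOpenMap_im
  exact h1.open_subset_closure_inter (isOpen_lt continuous_const continuous_norm)

lemma aux_schwarz {G : ℂ → ℂ} {z : ℂ} {s : ℝ} (hs : 0 < s)
    (hG : DifferentiableOn ℂ G (ball z s)) (hp : ∀ w ∈ ball z s, 0 < (G w).im) :
    ‖deriv G z‖ ≤ 2 * (G z).im / s := by
  set a := G z with ha
  set b : ℂ := (starRingEnd ℂ) a with hb
  have ha0 : 0 < a.im := hp z (mem_ball_self hs)
  have hden : ∀ w ∈ ball z s, G w - b ≠ 0 := by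
    intro w hw h
    have := congrArg Complex.im h
    simp [hb] at this
    linarith [hp w hw]
  have hab : a - b ≠ 0 := hden z (mem_ball_self hs)
  have habn : ‖a - b‖ = 2 * a.im := by
    have : a - b = ((2 * a.im : ℝ) : ℂ) * I := by
      apply Complex.ext <;> simp [hb]; ring
    rw [this, norm_mul, norm_I, mul_one, norm_real, Real.norm_eq_abs, abs_of_pos (by linarith)]
  have hcd : DifferentiableOn ℂ (fun w => (G w - a) / (G w - b)) (ball z s) :=
    (hG.sub_const a).div (hG.sub_const b) hden
  have hmap : MapsTo (fun w => (G w - a) / (G w - b)) (ball z s)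
      (closedBall ((fun w => (G w - a) / (G w - b)) z) 1) := by
    intro w hw
    have h0 : (fun w => (G w - a) / (G w - b)) z = 0 := by simp [ha]
    rw [h0, mem_closedBall, dist_zero_right, norm_div]
    refine div_le_one_of_le₀ ?_ (norm_nonneg _)
    have hw0 := hp w hw
    rw [← sq_le_sq₀ (norm_nonneg _) (norm_nonneg _), ← normSq_eq_norm_sq, ← normSq_eq_norm_sq,
      normSq_apply, normSq_apply]
    simp only [hb, sub_re, sub_im, conj_re, conj_im]
    nlinarith
  have key := Complex.norm_deriv_le_div_of_mapsTo_ball hcd hmap hs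
  have hGz : HasDerivAt G (deriv G z) z :=
    (hG.differentiableAt (ball_mem_nhds z hs)).hasDerivAt
  have hder := ((hGz.sub_const a).div (hGz.sub_const b) (hden z (mem_ball_self hs))).deriv
  have : deriv (fun w => (G w - a) / (G w - b)) z = deriv G z / (a - b) := by
    refine hder.trans ?_
    rw [← ha]
    field_simp
    ring
  rw [this, norm_div, habn, div_le_iff₀ (by linarith)] at key
  calc _ ≤ _ := key
    _ = _ := by ring

/-- Reflection of a function on the upper half-plane. -/
def reflG (G : ℂ → ℂ) (z : ℂ) : ℂ :=
  if 0 < z.im then G z else (starRingEnd ℂ) (G ((starRingEnd ℂ) z))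

lemma aux_lip {G : ℂ → ℂ} (hG : ∀ z : ℂ, 0 < z.im → 1 < ‖z‖ → DifferentiableAt ℂ G z)
    (hp : ∀ z : ℂ, 0 < z.im → 1 < ‖z‖ → 0 < (G z).im ∧ (G z).im ≤ z.im)
    {x : ℂ} (hx : x.im = 0) (hx1 : 1 < ‖x‖) :
    ∀ z ∈ ball x ((‖x‖ - 1) / 2), ∀ w ∈ ball x ((‖x‖ - 1) / 2), 0 < z.im → 0 < w.im →
      ‖G z - G w‖ ≤ 2 * ‖z - w‖ := by
  intro z hz w hw hz0 hw0
  set s := (‖x‖ - 1) / 2 with hs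
  have hs0 : 0 < s := by rw [hs]; linarith
  have hconv : Convex ℝ (ball x s ∩ {z : ℂ | 0 < z.im}) :=
    (convex_ball x s).inter ((convex_Ioi (0:ℝ)).linear_preimage imLm)
  have hsub : ∀ v ∈ ball x s, 0 < v.im → ball v v.im ⊆ {u : ℂ | 0 < u.im ∧ 1 < ‖u‖} := by
    intro v hv hv0 u hu
    have h1 : |u.im - v.im| ≤ ‖u - v‖ := by simpa using abs_im_le_norm (u - v)
    have h2 : |v.im - x.im| ≤ ‖v - x‖ := by simpa using abs_im_le_norm (v - x)
    rw [hx, sub_zero] at h2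
    rw [mem_ball, dist_eq_norm] at hu hv
    have h3 : ‖x‖ ≤ ‖u‖ + ‖u - v‖ + ‖v - x‖ := by
      have e1 := norm_sub_le u (u - v)
      have e2 := norm_sub_le (u - (u - v)) (v - x)
      have e3 : u - (u - v) - (v - x) = x := by ring
      rw [e3] at e2
      linarith
    have h5 := abs_le.1 h1
    have h6 := le_abs_self v.im
    refine ⟨by linarith [h5.1], ?_⟩
    rw [hs] at hv
    linarith
  have := hconv.norm_image_sub_le_of_norm_deriv_le (f := G) (C := 2) (𝕜 := ℂ) (x := w) (y := z)
    ?_ ?_ ⟨hw, hw0⟩ ⟨hz, hz0⟩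
  · exact this
  · rintro v ⟨hv, hv0⟩
    have := hsub v hv hv0 (mem_ball_self hv0)
    exact hG v this.1 this.2
  · rintro v ⟨hv, hv0⟩
    have hv0 : 0 < v.im := hv0
    have h1 := hsub v hv hv0
    have h2 := aux_schwarz hv0 (fun u hu => (hG u (h1 hu).1 (h1 hu).2).differentiableWithinAt)
      (fun u hu => (hp u (h1 hu).1 (h1 hu).2).1)
    refine h2.trans ?_
    have h3 := h1 (mem_ball_self hv0)
    rw [div_le_iff₀ hv0]
    linarith [(hp v h3.1 h3.2).2]

lemma aux_lip2 {G : ℂ → ℂ} (hG : ∀ z : ℂ, 0 < z.im → 1 < ‖z‖ → DifferentiableAt ℂ G z)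
    (hp : ∀ z : ℂ, 0 < z.im → 1 < ‖z‖ → 0 < (G z).im ∧ (G z).im ≤ z.im)
    {x : ℂ} (hx : x.im = 0) (hx1 : 1 < ‖x‖) :
    ∀ z ∈ ball x ((‖x‖ - 1) / 2), ∀ w ∈ ball x ((‖x‖ - 1) / 2), z.im ≠ 0 → w.im ≠ 0 →
      ‖reflG G z - reflG G w‖ ≤ 4 * ‖z - w‖ := by
  have L := aux_lip hG hp hx hx1
  have hconj : ∀ z ∈ ball x ((‖x‖ - 1) / 2), (starRingEnd ℂ) z ∈ ball x ((‖x‖ - 1) / 2) := by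
    intro z hz
    have hxx : (starRingEnd ℂ) x = x := Complex.conj_eq_iff_im.2 hx
    rw [mem_ball, dist_eq_norm] at hz ⊢
    have e : (starRingEnd ℂ) z - x = (starRingEnd ℂ) (z - x) := by rw [map_sub, hxx]
    rw [e, Complex.norm_conj]
    exact hz
  have hnorm : ∀ z ∈ ball x ((‖x‖ - 1) / 2), 1 < ‖z‖ := by
    intro z hz
    rw [mem_ball, dist_eq_norm] at hz
    have := norm_sub_le z (z - x)
    rw [sub_sub_cancel] at this
    linarith
  -- mixed case
  have hmix : ∀ z ∈ ball x ((‖x‖ - 1) / 2), ∀ w ∈ ball x ((‖x‖ - 1) / 2), 0 < z.im → w.im < 0 →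
      ‖reflG G z - reflG G w‖ ≤ 4 * ‖z - w‖ := by
    intro z hz w hw hz0 hw0
    set v := (starRingEnd ℂ) w with hv
    have hv0 : 0 < v.im := by simp [hv, hw0]
    have hvb := hconj w hw
    have h1 := L z hz v hvb hz0 hv0
    have h2 := hp v hv0 (hnorm v hvb)
    have hwv : w = (starRingEnd ℂ) v := by simp [hv]
    simp only [reflG, hz0, if_true, not_lt.2 hw0.le, if_false]
    have h3 : ‖G v - (starRingEnd ℂ) (G v)‖ = 2 * (G v).im := by
      have : G v - (starRingEnd ℂ) (G v) = ((2 * (G v).im : ℝ) : ℂ) * I := by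
        apply Complex.ext <;> simp; ring
      rw [this, norm_mul, norm_I, mul_one, norm_real, Real.norm_eq_abs, abs_of_pos (by linarith)]
    have h4 : v.im ≤ ‖z - w‖ := by
      have h5 := (le_abs_self _).trans (abs_im_le_norm (z - w))
      have : (z - w).im = z.im + v.im := by
        simp [hv, sub_eq_add_neg]
      linarith
    have h5 : ‖z - v‖ ≤ ‖z - w‖ := by
      rw [← sq_le_sq₀ (norm_nonneg _) (norm_nonneg _), ← normSq_eq_norm_sq, ← normSq_eq_norm_sq,
        normSq_apply, normSq_apply]
      simp only [hv, sub_re, sub_im, conj_re, conj_im]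
      nlinarith
    have h6 : ‖G z - (starRingEnd ℂ) (G v)‖ ≤ ‖G z - G v‖ + ‖G v - (starRingEnd ℂ) (G v)‖ := by
      have := norm_add_le (G z - G v) (G v - (starRingEnd ℂ) (G v))
      simpa using this
    linarith
  intro z hz w hw hz0 hw0
  rcases lt_or_gt_of_ne hz0 with h1 | h1 <;> rcases lt_or_gt_of_ne hw0 with h2 | h2
  · simp only [reflG, not_lt.2 h1.le, not_lt.2 h2.le, if_false]
    rw [← map_sub, Complex.norm_conj]
    have := L _ (hconj z hz) _ (hconj w hw) (by simpa using h1) (by simpa using h2)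
    rw [← map_sub, Complex.norm_conj] at this
    linarith [norm_nonneg (z - w)]
  · rw [norm_sub_rev, norm_sub_rev z w]
    exact hmix w hw z hz h2 h1
  · exact hmix z hz w hw h1 h2
  · simp only [reflG, h1, h2, if_true]
    linarith [L z hz w hw h1 h2, norm_nonneg (z - w)]

lemma aux_refl {G : ℂ → ℂ} (hG : ∀ z : ℂ, 0 < z.im → 1 < ‖z‖ → DifferentiableAt ℂ G z)
    (hp : ∀ z : ℂ, 0 < z.im → 1 < ‖z‖ → 0 < (G z).im ∧ (G z).im ≤ z.im) :
    ∃ E : ℂ → ℂ, DifferentiableOn ℂ E {z : ℂ | 1 < ‖z‖} ∧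
      (∀ z : ℂ, 1 < ‖z‖ → 0 < z.im → E z = G z) ∧
      (∀ z : ℂ, 1 < ‖z‖ → z.im < 0 → E z = (starRingEnd ℂ) (G ((starRingEnd ℂ) z))) ∧
      (∀ z : ℂ, 1 < ‖z‖ → z.im = 0 → (E z).im = 0) := by
  set A : Set ℂ := {z : ℂ | 1 < ‖z‖ ∧ z.im ≠ 0} with hA
  have hBo : IsOpen {z : ℂ | 1 < ‖z‖} := isOpen_lt continuous_const continuous_norm
  have hAo : IsOpen A := hBo.inter (isOpen_ne_fun continuous_im continuous_const)
  have hdA : ∀ z ∈ A, DifferentiableAt ℂ (reflG G) z := by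
    rintro z ⟨hz1, hz0⟩
    rcases lt_or_gt_of_ne hz0 with h | h
    · have h1 : DifferentiableAt ℂ ((starRingEnd ℂ) ∘ G ∘ (starRingEnd ℂ)) z := by
        rw [differentiableAt_conj_conj_iff]
        exact hG _ (by simpa using h) (by simpa using hz1)
      refine h1.congr_of_eventuallyEq ?_
      filter_upwards [(isOpen_lt continuous_im continuous_const).mem_nhds h] with w hw
      simp only [reflG, not_lt.2 (le_of_lt (show w.im < 0 from hw)), if_false, comp_apply]
    · refine (hG z h hz1).congr_of_eventuallyEq ?_
      filter_upwards [(isOpen_lt continuous_const continuous_im).mem_nhds h] with w hw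
      simp only [reflG, show 0 < w.im from hw, if_true]
  have hlimit : ∀ x ∈ {z : ℂ | 1 < ‖z‖}, ∃ y, Tendsto (reflG G) (𝓝[A] x) (𝓝 y) := by
    intro x hx
    by_cases hx0 : x.im = 0
    · have hL := aux_lip2 hG hp hx0 hx
      have hlip : LipschitzOnWith 4 (reflG G) (A ∩ ball x ((‖x‖ - 1) / 2)) := by
        refine LipschitzOnWith.of_dist_le_mul fun z hz w hw => ?_
        rw [dist_eq_norm, dist_eq_norm]
        exact hL z hz.2 w hw.2 hz.1.2 hw.1.2
      have hne : (𝓝[A] x).NeBot := mem_closure_iff_nhdsWithin_neBot.mp (aux_dense hx)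
      have hc : Cauchy (𝓝[A] x) := cauchy_nhds.mono nhdsWithin_le_nhds
      have hx' : 1 < ‖x‖ := hx
      have hle : 𝓝[A] x ≤ 𝓟 (A ∩ ball x ((‖x‖ - 1) / 2)) := by
        rw [le_principal_iff]
        exact inter_mem self_mem_nhdsWithin
          (mem_nhdsWithin_of_mem_nhds (ball_mem_nhds x (by linarith)))
      have := hc.map_of_le hlip.uniformContinuousOn hle
      obtain ⟨y, hy⟩ := CompleteSpace.complete this
      exact ⟨y, hy⟩
    · exact ⟨_, ((hdA x ⟨hx, hx0⟩).continuousAt.tendsto).mono_left nhdsWithin_le_nhds⟩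
  have hcA : ContinuousOn (reflG G) A := fun z hz => (hdA z hz).continuousAt.continuousWithinAt
  have hext : ∀ z ∈ A, extendFrom A (reflG G) z = reflG G z := extendFrom_extends hcA
  refine ⟨extendFrom A (reflG G), ?_, ?_, ?_, ?_⟩
  · refine aux_painleve hBo (continuousOn_extendFrom aux_dense hlimit) ?_
    intro z hz hz0
    have hzA : z ∈ A := ⟨hz, hz0⟩
    refine (hdA z hzA).congr_of_eventuallyEq ?_
    filter_upwards [hAo.mem_nhds hzA] with w hw
    exact hext w hw
  · intro z hz hz0
    rw [hext z ⟨hz, hz0.ne'⟩]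
    simp only [reflG, hz0, if_true]
  · intro z hz hz0
    rw [hext z ⟨hz, hz0.ne⟩]
    simp only [reflG, not_lt.2 hz0.le, if_false]
  · intro z hz hz0
    have hne : (𝓝[A] z).NeBot := mem_closure_iff_nhdsWithin_neBot.mp (aux_dense hz)
    have ht := tendsto_extendFrom (hlimit z hz)
    have h1 : Tendsto (fun w => |(reflG G w).im|) (𝓝[A] z)
        (𝓝 |(extendFrom A (reflG G) z).im|) :=
      ((continuous_abs.comp continuous_im).tendsto _).comp ht
    have h2 : Tendsto (fun w : ℂ => |w.im|) (𝓝[A] z) (𝓝 |z.im|) :=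
      ((continuous_abs.comp continuous_im).tendsto z).mono_left nhdsWithin_le_nhds
    have h3 := le_of_tendsto_of_tendsto h1 h2 (by
      filter_upwards [self_mem_nhdsWithin] with w hw
      rcases lt_or_gt_of_ne hw.2 with h | h
      · have := hp ((starRingEnd ℂ) w) (by simpa using h) (by simpa using hw.1)
        simp only [reflG, not_lt.2 h.le, if_false, conj_im, abs_neg]
        rw [abs_of_pos this.1, abs_of_neg h]
        simpa using this.2
      · have := hp w h hw.1
        simp only [reflG, h, if_true]
        rw [abs_of_pos this.1, abs_of_pos h]
        exact this.2)
    rw [hz0, abs_zero] at h3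
    exact abs_eq_zero.1 (le_antisymm h3 (abs_nonneg _))

lemma aux_main {f : ℂ → ℂ} (hf : DifferentiableOn ℂ f {z : ℂ | 0 < z.im})
    (hinj : InjOn f {z : ℂ | 0 < z.im})
    (hmaps : ∀ z : ℂ, 0 < z.im → 0 < (f z).im)
    (hsurj : ∀ z : ℂ, 0 < z.im → 1 ≤ ‖z‖ → ∃ w : ℂ, 0 < w.im ∧ f w = z)
    (hlim : ∀ ε > 0, ∃ R : ℝ, ∀ z : ℂ, 0 < z.im → R ≤ ‖z‖ → ‖f z - z‖ < ε)
    (w₀ : ℂ) (hw₀ : 0 < w₀.im) (hfw : ‖f w₀‖ < 1) : ‖w₀‖ ≤ 2 := by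
  set g : ℂ → ℂ := invFunOn f {z : ℂ | 0 < z.im} with hgdef
  have hgf : ∀ z : ℂ, 0 < z.im → g (f z) = z := fun z hz => hinj.leftInvOn_invFunOn hz
  have hg : ∀ z : ℂ, 0 < z.im → 1 < ‖z‖ → 0 < (g z).im ∧ f (g z) = z := by
    intro z h1 h2
    obtain ⟨w, hw, rfl⟩ := hsurj z h1 h2.le
    rw [hgf w hw]
    exact ⟨hw, rfl⟩
  have hGd : ∀ z : ℂ, 0 < z.im → 1 < ‖z‖ → DifferentiableAt ℂ g z := by
    intro z h1 h2
    obtain ⟨w, hw, rfl⟩ := hsurj z h1 h2.le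
    exact aux_inv aux_isOpenUHP hf hinj hgf hw
  have hp : ∀ z : ℂ, 0 < z.im → 1 < ‖z‖ → 0 < (g z).im ∧ (g z).im ≤ z.im := by
    intro z h1 h2
    obtain ⟨h3, h4⟩ := hg z h1 h2
    refine ⟨h3, ?_⟩
    have := aux_im hf hmaps hlim (g z) h3
    rwa [h4] at this
  have hinf := aux_inf (fun z hz => (hGd z hz.1 hz.2).continuousAt.continuousWithinAt)
    hgf hmaps hg hlim
  obtain ⟨E, hEd, hEu, hEl, hEr⟩ := aux_refl hGd hp
  have hBo : IsOpen {z : ℂ | 1 < ‖z‖} := isOpen_lt continuous_const continuous_norm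
  have hEinf : ∀ ε > 0, ∃ R : ℝ, ∀ z : ℂ, R < ‖z‖ → ‖E z - z‖ ≤ ε := by
    intro ε hε
    obtain ⟨R', hR'⟩ := hinf ε hε
    refine ⟨max R' 1, ?_⟩
    have hA : ∀ z : ℂ, max R' 1 < ‖z‖ → z.im ≠ 0 → ‖E z - z‖ ≤ ε := by
      intro z hz hz0
      have hz1 : 1 < ‖z‖ := (le_max_right _ _).trans_lt hz
      have hz2 : R' < ‖z‖ := (le_max_left _ _).trans_lt hz
      rcases lt_or_gt_of_ne hz0 with h | h
      · rw [hEl z hz1 h]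
        have := hR' ((starRingEnd ℂ) z) (by simpa using h) (by simpa using hz2)
        rw [← Complex.norm_conj, map_sub, Complex.conj_conj] at this
        exact this.le
      · rw [hEu z hz1 h]
        exact (hR' z h hz2).le
    intro z hz
    have hz1 : 1 < ‖z‖ := (le_max_right _ _).trans_lt hz
    have hne : (𝓝[{z : ℂ | 1 < ‖z‖ ∧ z.im ≠ 0}] z).NeBot :=
      mem_closure_iff_nhdsWithin_neBot.mp (aux_dense hz1)
    have hc : ContinuousAt (fun z => ‖E z - z‖) z :=
      ((hEd.differentiableAt (hBo.mem_nhds hz1)).continuousAt.sub continuousAt_id).norm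
    refine le_of_tendsto (hc.tendsto.mono_left
      (nhdsWithin_le_nhds (s := {z : ℂ | 1 < ‖z‖ ∧ z.im ≠ 0}))) ?_
    filter_upwards [self_mem_nhdsWithin, mem_nhdsWithin_of_mem_nhds
      ((isOpen_lt continuous_const continuous_norm).mem_nhds hz)] with w hw hw2
    exact hA w hw2 hw.2
  have hEuim : ∀ z : ℂ, 1 < ‖z‖ → 0 < z.im → 0 < (E z).im := by
    intro z h1 h2; rw [hEu z h1 h2]; exact (hp z h2 h1).1
  have hElim : ∀ z : ℂ, 1 < ‖z‖ → z.im < 0 → (E z).im < 0 := by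
    intro z h1 h2
    rw [hEl z h1 h2, conj_im]
    have := (hp ((starRingEnd ℂ) z) (by simpa using h2) (by simpa using h1)).1
    linarith
  have hginj : ∀ z w : ℂ, 0 < z.im → 1 < ‖z‖ → 0 < w.im → 1 < ‖w‖ → g z = g w → z = w := by
    intro z w h1 h2 h3 h4 h
    rw [← (hg z h1 h2).2, h, (hg w h3 h4).2]
  have hEinj : ∀ z w : ℂ, 1 < ‖z‖ → z.im ≠ 0 → 1 < ‖w‖ → w.im ≠ 0 → E z = E w → z = w := by
    intro z w h1 h2 h3 h4 h
    rcases lt_or_gt_of_ne h2 with h5 | h5 <;> rcases lt_or_gt_of_ne h4 with h6 | h6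
    · rw [hEl z h1 h5, hEl w h3 h6] at h
      have h' := (starRingEnd ℂ).injective h
      have := hginj _ _ (by simpa using h5) (by simpa using h1) (by simpa using h6)
        (by simpa using h3) h'
      exact (starRingEnd ℂ).injective this
    · have e1 := hElim z h1 h5
      have e2 := hEuim w h3 h6
      rw [h] at e1; linarith
    · have e1 := hElim w h3 h6
      have e2 := hEuim z h1 h5
      rw [h] at e2; linarith
    · rw [hEu z h1 h5, hEu w h3 h6] at h
      exact hginj _ _ h5 h1 h6 h3 h
  have hEw : ∀ z : ℂ, 1 < ‖z‖ → E z ≠ w₀ := by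
    intro z hz h
    rcases lt_trichotomy z.im 0 with h1 | h1 | h1
    · have := hElim z hz h1
      rw [h] at this; linarith
    · have := hEr z hz h1
      rw [h] at this; linarith
    · rw [hEu z hz h1] at h
      have := (hg z h1 hz).2
      rw [h] at this
      rw [this] at hfw
      linarith
  obtain ⟨R₁', hR₁'⟩ := hlim 1 one_pos
  set R₁ := max R₁' 1 with hR₁def
  have hR₁1 : 1 ≤ R₁ := le_max_right _ _
  have hgb : ∀ S, R₁ ≤ S → ∀ z : ℂ, 0 < z.im → 1 < ‖z‖ → ‖z‖ < S → ‖g z‖ ≤ S + 1 := by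
    intro S hS z h1 h2 h3
    by_contra hcon
    push Not at hcon
    obtain ⟨h4, h5⟩ := hg z h1 h2
    have h6 := hR₁' (g z) h4 (by linarith [le_max_left R₁' 1])
    rw [h5, norm_sub_rev] at h6
    have h7 := norm_add_le (g z - z) z
    rw [sub_add_cancel] at h7
    linarith
  have hEb : ∀ S, R₁ ≤ S → ∀ z : ℂ, z.im ≠ 0 → 1 < ‖z‖ → ‖z‖ < S → ‖E z‖ ≤ S + 1 := by
    intro S hS z h1 h2 h3
    rcases lt_or_gt_of_ne h1 with h | h
    · rw [hEl z h2 h, Complex.norm_conj]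
      exact hgb S hS _ (by simpa using h) (by simpa using h2) (by simpa using h3)
    · rw [hEu z h2 h]
      exact hgb S hS z h h2 h3
  -- inversion
  have hinvn : ∀ z ∈ ball (0:ℂ) 1, z ≠ 0 → 1 < ‖z⁻¹‖ := by
    intro z hz hz0
    rw [mem_ball, dist_zero_right] at hz
    rw [norm_inv]
    exact (one_lt_inv₀ (norm_pos_iff.2 hz0)).2 hz
  have hinvi : ∀ z : ℂ, z.im ≠ 0 → z ≠ 0 ∧ (z⁻¹).im ≠ 0 := by
    intro z hz
    have hz0 : z ≠ 0 := by rintro rfl; simp at hz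
    refine ⟨hz0, ?_⟩
    rw [inv_im]
    exact div_ne_zero (neg_ne_zero.2 hz) (by simpa using hz0)
  set m : ℂ → ℂ := fun ζ => if ζ = 0 then 0 else E ζ⁻¹ - ζ⁻¹ with hm
  have hm0 : m 0 = 0 := by simp [hm]
  have hmz : ∀ ζ : ℂ, ζ ≠ 0 → m ζ = E ζ⁻¹ - ζ⁻¹ := fun ζ h => by simp [hm, h]
  have hmd : DifferentiableOn ℂ m (ball 0 1) := by
    rw [← Complex.differentiableOn_compl_singleton_and_continuousAt_iff
      (ball_mem_nhds (0:ℂ) one_pos)]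
    constructor
    · rintro z ⟨hz, hz0⟩
      have hz0 : z ≠ 0 := hz0
      have h1 : DifferentiableAt ℂ (fun ζ : ℂ => E ζ⁻¹ - ζ⁻¹) z := by
        have h2 : DifferentiableAt ℂ (fun ζ : ℂ => ζ⁻¹) z := differentiableAt_inv hz0
        have h3 := hEd.differentiableAt (hBo.mem_nhds (hinvn z hz hz0))
        exact (DifferentiableAt.comp z h3 h2).sub h2
      refine (h1.congr_of_eventuallyEq ?_).differentiableWithinAt
      filter_upwards [isOpen_compl_singleton.mem_nhds hz0] with w hw
      exact hmz w hw
    · rw [Metric.continuousAt_iff]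
      intro ε hε
      obtain ⟨R, hR⟩ := hEinf (ε / 2) (by linarith)
      refine ⟨(max R 1)⁻¹, by positivity, ?_⟩
      intro z hz
      rw [hm0, dist_zero_right]
      by_cases hz0 : z = 0
      · rw [hz0, hm0]; simpa using hε
      · rw [hmz z hz0]
        rw [dist_zero_right] at hz
        have h1 : max R 1 < ‖z⁻¹‖ := by
          rw [norm_inv]
          exact (lt_inv_comm₀ (norm_pos_iff.2 hz0) (by positivity)).1 hz
        have := hR z⁻¹ ((le_max_left _ _).trans_lt h1)
        linarith
  set k : ℂ → ℂ := fun ζ => 1 - w₀ * ζ + ζ * m ζ with hk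
  have hkz : ∀ ζ : ℂ, ζ ≠ 0 → k ζ / ζ = E ζ⁻¹ - w₀ := by
    intro ζ h
    simp only [hk]
    rw [hmz ζ h]
    field_simp
    ring
  have hkd : DifferentiableOn ℂ k (ball 0 1) :=
    ((differentiableOn_const 1).sub (differentiableOn_id.const_mul w₀)).add
      (differentiableOn_id.mul hmd)
  have hk0 : k 0 = 1 := by simp [hk]
  have hderiv : deriv k 0 = -w₀ := by
    have h1 : HasDerivAt m (deriv m 0) 0 :=
      (hmd.differentiableAt (ball_mem_nhds (0:ℂ) one_pos)).hasDerivAt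
    have h2 := (((hasDerivAt_id (0:ℂ)).const_mul w₀).const_sub 1).add
      ((hasDerivAt_id (0:ℂ)).mul h1)
    refine h2.deriv.trans ?_
    simp [hm0]
  have key := aux_area k hkd ?_ hk0 ?_ (‖w₀‖ + 2) R₁⁻¹ (by positivity) (by positivity) ?_
  · rwa [hderiv, norm_neg] at key
  · intro z hz h
    by_cases hz0 : z = 0
    · rw [hz0, hk0] at h; exact one_ne_zero h
    · have h1 := hkz z hz0
      rw [h, zero_div] at h1
      exact hEw _ (hinvn z hz hz0) (sub_eq_zero.1 h1.symm)
  · rintro z ⟨hz, hz1⟩ w ⟨hw, hw1⟩ h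
    obtain ⟨a1, a2⟩ := hinvi z hz1
    obtain ⟨b1, b2⟩ := hinvi w hw1
    simp only at h
    rw [hkz z a1, hkz w b1] at h
    exact inv_injective (hEinj _ _ (hinvn z hz a1) a2 (hinvn w hw b1) b2 (sub_left_injective h))
  · intro ε hε hε1 z hz hεz hz1
    obtain ⟨a1, a2⟩ := hinvi z hz1
    rw [hkz z a1]
    have h1 : ‖z⁻¹‖ < ε⁻¹ := by
      rw [norm_inv]
      exact inv_strictAnti₀ hε hεz
    have h2 : R₁ ≤ ε⁻¹ := ((lt_inv_comm₀ hε (by linarith)).1 hε1).le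
    have h3 := hEb _ h2 _ a2 (hinvn z hz a1) h1
    have h4 := norm_sub_le (E z⁻¹) w₀
    linarith

end Helpers

/-- **Lemma `supp`(ii).** If `K ⊂ B(x,r)` with `x ∈ ℝ`, then
`ℍ \ B(x,2r) ⊆ f⁻¹(ℍ \ B(x,r))` for the hydrodynamic map `f`. -/
theorem hydro_omitted_values (K : Set ℂ) (f : ℂ → ℂ) (x r : ℝ) (hr : 0 < r)
    (hK : IsHull K) (hf : IsHydroMap K f) (hKB : K ⊆ Metric.ball (x : ℂ) r) :
    ∀ w ∈ UHP, 2 * r ≤ dist w (x : ℂ) → r ≤ dist (f w) (x : ℂ) := by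
  obtain ⟨hfd, hinj, himg, hlim⟩ := hf
  have hrC : (r : ℂ) ≠ 0 := by exact_mod_cast hr.ne'
  have hmapsF : ∀ z ∈ UHP, f z ∈ UHP := by
    intro z hz
    have : f z ∈ f '' UHP := ⟨z, hz, rfl⟩
    rw [himg] at this
    exact this.1
  -- normalisation to the unit ball
  have him : ∀ z : ℂ, ((x : ℂ) + r * z).im = r * z.im := by intro z; simp
  have hin : ∀ z : ℂ, 0 < z.im → (x : ℂ) + r * z ∈ UHP := by
    intro z hz
    show 0 < ((x : ℂ) + r * z).im
    rw [him]; positivity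
  have himF : ∀ u : ℂ, ((u - (x : ℂ)) / r).im = u.im / r := by
    intro u; rw [Complex.div_ofReal_im]; simp
  set F : ℂ → ℂ := fun z => (f ((x : ℂ) + r * z) - x) / r with hF
  have hnF : ∀ z, ‖F z‖ = ‖f ((x : ℂ) + r * z) - x‖ / r := by
    intro z
    simp only [hF, norm_div, norm_real, Real.norm_eq_abs, abs_of_pos hr]
  have hFd : DifferentiableOn ℂ F {z : ℂ | 0 < z.im} := by
    refine DifferentiableOn.div_const (DifferentiableOn.sub_const ?_ _) _
    refine hfd.comp (g := f) (t := UHP) (by fun_prop) ?_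
    intro z hz
    exact hin z hz
  have hFinj : InjOn F {z : ℂ | 0 < z.im} := by
    intro z hz w hw h
    simp only [hF] at h
    have h1 : f ((x : ℂ) + r * z) = f ((x : ℂ) + r * w) := by
      field_simp at h
      linear_combination h
    have h2 := hinj (hin z hz) (hin w hw) h1
    exact mul_left_cancel₀ hrC (add_left_cancel h2)
  have hFm : ∀ z : ℂ, 0 < z.im → 0 < (F z).im := by
    intro z hz
    simp only [hF]
    rw [himF]
    exact div_pos (hmapsF _ (hin z hz)) hr
  have hFs : ∀ z : ℂ, 0 < z.im → 1 ≤ ‖z‖ → ∃ w : ℂ, 0 < w.im ∧ F w = z := by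
    intro z hz hz1
    have h1 : (x : ℂ) + r * z ∈ UHP \ K := by
      refine ⟨hin z hz, fun h => ?_⟩
      have h2 := hKB h
      rw [Metric.mem_ball, dist_eq_norm, add_sub_cancel_left, norm_mul, norm_real,
        Real.norm_eq_abs, abs_of_pos hr] at h2
      nlinarith
    rw [← himg] at h1
    obtain ⟨u, hu, hu2⟩ := h1
    refine ⟨(u - x) / r, ?_, ?_⟩
    · rw [himF]
      exact div_pos hu hr
    · simp only [hF]
      rw [mul_div_cancel₀ _ hrC, add_sub_cancel, hu2]
      field_simp
      ring
  have hFl : ∀ ε > 0, ∃ R : ℝ, ∀ z : ℂ, 0 < z.im → R ≤ ‖z‖ → ‖F z - z‖ < ε := by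
    intro ε hε
    have h1 := (Metric.tendsto_nhds.1 hlim) (ε * r) (by positivity)
    rw [eventually_inf_principal] at h1
    obtain ⟨R, hR, hR2⟩ := (Filter.hasBasis_cobounded_norm.eventually_iff).1 h1
    refine ⟨(R + |x|) / r, fun z hz hz1 => ?_⟩
    have h2 : R ≤ ‖(x : ℂ) + r * z‖ := by
      have e1 := norm_sub_le ((x : ℂ) + r * z) x
      rw [add_sub_cancel_left, norm_mul, norm_real, norm_real, Real.norm_eq_abs, Real.norm_eq_abs,
        abs_of_pos hr] at e1
      rw [div_le_iff₀ hr] at hz1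
      linarith
    have h3 := hR2 h2 (hin z hz)
    rw [dist_zero_right] at h3
    have h4 : F z - z = (f ((x : ℂ) + r * z) - ((x : ℂ) + r * z)) / r := by
      simp only [hF]
      field_simp
      ring
    rw [h4, norm_div, norm_real, Real.norm_eq_abs, abs_of_pos hr, div_lt_iff₀ hr]
    exact h3
  intro w hw hwd
  by_contra hcon
  push Not at hcon
  set v : ℂ := (w - x) / r with hv
  have hv0 : 0 < v.im := by
    rw [hv, himF]
    exact div_pos hw hr
  have hvn : 2 ≤ ‖v‖ := by
    rw [hv, norm_div, norm_real, Real.norm_eq_abs, abs_of_pos hr, le_div_iff₀ hr, ← dist_eq_norm]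
    exact hwd
  have hFv : ‖F v‖ < 1 := by
    rw [hnF, hv, mul_div_cancel₀ _ hrC, add_sub_cancel, div_lt_one hr, ← dist_eq_norm]
    exact hcon
  have hcF : ContinuousAt F v := (hFd.differentiableAt (aux_isOpenUHP.mem_nhds hv0)).continuousAt
  have hcT : ContinuousAt (fun t : ℝ => ‖F ((t : ℂ) * v)‖) 1 := by
    have h1 : ContinuousAt (fun t : ℝ => (t : ℂ) * v) 1 := by fun_prop
    refine ContinuousAt.norm (ContinuousAt.comp (g := F) ?_ h1)
    simpa using hcF
  have hev : ∀ᶠ t : ℝ in nhds 1, ‖F ((t : ℂ) * v)‖ < 1 := by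
    refine hcT.eventually_lt continuousAt_const ?_
    simpa using hFv
  have hev2 : ∀ᶠ t : ℝ in nhdsWithin 1 (Ioi 1), ‖F ((t : ℂ) * v)‖ < 1 ∧ 1 < t :=
    (hev.filter_mono nhdsWithin_le_nhds).and self_mem_nhdsWithin
  obtain ⟨t, ht1, ht2⟩ := hev2.exists
  have h0 : 0 < ((t : ℂ) * v).im := by
    rw [Complex.im_ofReal_mul]
    positivity
  have key := aux_main hFd hFinj hFm hFs hFl ((t : ℂ) * v) h0 ht1
  rw [norm_mul, norm_real, Real.norm_eq_abs, abs_of_pos (by linarith)] at key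
  nlinarith
end
end

section
/- Let K be a half-plane hull with hydrodynamic conformal map f : ℍ → ℍ \ K, and suppose K ⊂ B(x,r) for some x ∈ ℝ and r > 0. If a ∈ ℝ is such that z·(z − f(z)) → a as |z| → ∞ in ℍ (i.e., a = hcap(K)), then 0 ≤ a ≤ 4r². -/
open Set Metric Filter Bornology Complex Function

noncomputable section

lemma isOpen_UHP' : IsOpen UHP := isOpen_lt continuous_const Complex.continuous_im

/-- Minimum principle for the imaginary part of a holomorphic function. -/
lemma im_nonneg_of_compact_sublevel {D : Set ℂ} (hD : IsOpen D) {F : ℂ → ℂ}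
    (hF : DifferentiableOn ℂ F D)
    (hC : ∀ ε : ℝ, 0 < ε → ∃ C : Set ℂ, IsCompact C ∧ C ⊆ D ∧
      ∀ z ∈ D, (F z).im ≤ -ε → z ∈ C) :
    ∀ z ∈ D, 0 ≤ (F z).im := by
  intro z hz
  by_contra hneg
  push Not at hneg
  set ε : ℝ := -(F z).im / 2 with hε
  have hε0 : 0 < ε := by rw [hε]; linarith
  obtain ⟨C, hCc, hCD, hCs⟩ := hC ε hε0
  set U : Set ℂ := D ∩ (fun w => (F w).im) ⁻¹' (Iio (-ε)) with hU
  have hcont : ContinuousOn (fun w => (F w).im) D :=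
    Complex.continuous_im.comp_continuousOn hF.continuousOn
  have hUo : IsOpen U := hcont.isOpen_inter_preimage hD isOpen_Iio
  have hUC : U ⊆ C := fun w hw => hCs w hw.1 (le_of_lt hw.2)
  have hclC : closure U ⊆ C := closure_minimal hUC hCc.isClosed
  have hclD : closure U ⊆ D := hclC.trans hCD
  have hdiff : DiffContOnCl ℂ (fun w => Complex.exp (I * F w)) U := by
    apply DifferentiableOn.diffContOnCl
    exact ((hF.mono hclD).const_mul I).cexp
  have hfr : ∀ w ∈ frontier U, ‖Complex.exp (I * F w)‖ ≤ Real.exp ε := by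
    intro w hw
    rw [Complex.norm_exp]
    apply Real.exp_le_exp.2
    rw [hUo.frontier_eq] at hw
    have hwD := hclD hw.1
    have : ¬ ((F w).im < -ε) := fun h => hw.2 ⟨hwD, h⟩
    simp
    linarith
  have hzU : z ∈ U := ⟨hz, by simp only [mem_preimage, mem_Iio]; linarith⟩
  have h := Complex.norm_le_of_forall_mem_frontier_norm_le (hCc.isBounded.subset hUC) hdiff hfr
    (subset_closure hzU)
  rw [Complex.norm_exp, Real.exp_le_exp] at h
  simp at h
  linarith

lemma eventually_cobounded_UHP {p : ℂ → Prop} :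
    (∀ᶠ z in cobounded ℂ ⊓ 𝓟 UHP, p z) ↔ ∃ R : ℝ, ∀ z ∈ UHP, R ≤ ‖z‖ → p z := by
  rw [Filter.eventually_inf_principal, Filter.hasBasis_cobounded_norm.eventually_iff]
  constructor
  · rintro ⟨R, -, h⟩
    exact ⟨R, fun z hz hR => h hR hz⟩
  · rintro ⟨R, h⟩
    exact ⟨R, trivial, fun z hR hz => h z hz hR⟩

lemma preconnected_outer (ρ : ℝ) (hρ : 0 ≤ ρ) : IsPreconnected {z : ℂ | z ∈ UHP ∧ ρ < ‖z‖} := by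
  have h : {z : ℂ | z ∈ UHP ∧ ρ < ‖z‖} =
      (fun p : ℝ × ℝ => (p.1 : ℂ) * Complex.exp (p.2 * I)) '' (Ioi ρ ×ˢ Ioo 0 Real.pi) := by
    ext z
    constructor
    · rintro ⟨hz, hn⟩
      have hz' : 0 < z.im := hz
      refine ⟨(‖z‖, z.arg), ⟨hn, ?_, ?_⟩, Complex.norm_mul_exp_arg_mul_I z⟩
      · refine lt_of_le_of_ne (Complex.arg_nonneg_iff.2 hz'.le) ?_
        intro h0
        exact hz'.ne' (Complex.arg_eq_zero_iff.1 h0.symm).2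
      · exact Complex.arg_lt_pi_iff.2 (Or.inr hz'.ne')
    · rintro ⟨⟨s, t⟩, ⟨hs, ht⟩, rfl⟩
      have hs' : ρ < s := hs
      have ht' : 0 < t ∧ t < Real.pi := ht
      have hs0 : 0 < s := lt_of_le_of_lt hρ hs'
      constructor
      · show 0 < ((s : ℂ) * Complex.exp (t * I)).im
        rw [Complex.im_ofReal_mul, Complex.exp_ofReal_mul_I_im]
        exact mul_pos hs0 (Real.sin_pos_of_pos_of_lt_pi ht'.1 ht'.2)
      · show ρ < ‖(s : ℂ) * Complex.exp (t * I)‖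
        rw [norm_mul, Complex.norm_exp_ofReal_mul_I, mul_one, Complex.norm_real,
          Real.norm_of_nonneg hs0.le]
        exact hs'
  rw [h]
  apply IsPreconnected.image
  · exact isPreconnected_Ioi.prod isPreconnected_Ioo
  · fun_prop

lemma hydro_isOpen_image {K : Set ℂ} {f : ℂ → ℂ} (hf : IsHydroMap K f) :
    ∀ s ⊆ UHP, IsOpen s → IsOpen (f '' s) := by
  obtain ⟨hd, hinj, -, -⟩ := hf
  have hconv : Convex ℝ UHP := convex_halfSpace_im_gt 0
  rcases (hd.analyticOnNhd isOpen_UHP').is_constant_or_isOpen hconv.isPreconnected with ⟨w, hw⟩ | h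
  · exfalso
    have h1 : I ∈ UHP := by simp [UHP]
    have h2 : 2 * I ∈ UHP := by simp [UHP]
    have := hinj h1 h2 ((hw _ h1).trans (hw _ h2).symm)
    have := congrArg Complex.im this
    norm_num at this
  · exact h

lemma hydro_bounded {K : Set ℂ} {f : ℂ → ℂ} (hK : IsBounded K) (hf : IsHydroMap K f) (M : ℝ) :
    ∃ M' : ℝ, ∀ w ∈ UHP, ‖w‖ ≤ M → ‖f w‖ ≤ M' := by
  have hop := hydro_isOpen_image hf
  obtain ⟨hd, hinj, himg, hlim⟩ := hf
  obtain ⟨R₀, hR₀⟩ := eventually_cobounded_UHP.1 (hlim.eventually (ball_mem_nhds 0 one_pos))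
  obtain ⟨B, hB⟩ := hK.exists_norm_le
  set R := max (max R₀ M) (max B 0) with hR
  have hRR₀ : R₀ ≤ R := (le_max_left _ _).trans (le_max_left _ _)
  have hRM : M ≤ R := (le_max_right _ _).trans (le_max_left _ _)
  have hRB : B ≤ R := (le_max_left _ _).trans (le_max_right _ _)
  have hR0 : 0 ≤ R := (le_max_right _ _).trans (le_max_right _ _)
  have hclose : ∀ w ∈ UHP, R ≤ ‖w‖ → ‖f w - w‖ < 1 := by
    intro w hw h
    simpa using hR₀ w hw (hRR₀.trans h)
  have hsub : {z : ℂ | z ∈ UHP ∧ R + 1 < ‖z‖} ⊆ f '' (UHP ∩ {w | R < ‖w‖}) := by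
    apply IsPreconnected.subset_left_of_subset_union (v := f '' (UHP ∩ {w | ‖w‖ < R}))
    · exact hop _ inter_subset_left (isOpen_UHP'.inter (isOpen_lt continuous_const continuous_norm))
    · exact hop _ inter_subset_left (isOpen_UHP'.inter (isOpen_lt continuous_norm continuous_const))
    · rw [Set.disjoint_left]
      rintro _ ⟨u, hu, rfl⟩ ⟨v, hv, hvu⟩
      have := hinj hv.1 hu.1 hvu
      subst this
      have h1 : R < ‖v‖ := hu.2
      have h2 : ‖v‖ < R := hv.2
      linarith
    · rintro z ⟨hz, hzn⟩
      have hzK : z ∈ UHP \ K := ⟨hz, fun hk => by linarith [hB z hk]⟩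
      rw [← himg] at hzK
      obtain ⟨w, hw, rfl⟩ := hzK
      rcases lt_trichotomy ‖w‖ R with h | h | h
      · exact Or.inr ⟨w, ⟨hw, h⟩, rfl⟩
      · exfalso
        have h1 := hclose w hw h.ge
        have h2 : ‖f w‖ ≤ ‖f w - w‖ + ‖w‖ := by simpa using norm_add_le (f w - w) w
        linarith
      · exact Or.inl ⟨w, ⟨hw, h⟩, rfl⟩
    · set w : ℂ := ((R + 3 : ℝ) : ℂ) * I with hw
      have hwn : ‖w‖ = R + 3 := by
        rw [hw, norm_mul, Complex.norm_I, mul_one, Complex.norm_real, Real.norm_of_nonneg]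
        linarith
      have hwU : w ∈ UHP := by
        show 0 < w.im
        simp [hw]; linarith
      have h1 := hclose w hwU (by linarith)
      have h2 : ‖w‖ ≤ ‖f w - w‖ + ‖f w‖ := by
        have := norm_sub_le (f w) (f w - w)
        rw [sub_sub_cancel] at this
        linarith
      refine ⟨f w, ⟨?_, by linarith⟩, ⟨w, ⟨hwU, by simp only [mem_ofPred_eq]; linarith⟩, rfl⟩⟩
      have : f w ∈ UHP \ K := himg ▸ mem_image_of_mem f hwU
      exact this.1
    · exact preconnected_outer _ (by linarith)
  refine ⟨R + 1, fun w hw hwM => ?_⟩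
  by_contra hcon
  push Not at hcon
  have hfU : f w ∈ UHP \ K := himg ▸ mem_image_of_mem f hw
  obtain ⟨v, hv, hvw⟩ := hsub ⟨hfU.1, hcon⟩
  have := hinj hv.1 hw hvw
  subst this
  have : R < ‖v‖ := hv.2
  linarith

lemma invFunOn_continuousOn {K : Set ℂ} {f : ℂ → ℂ} (hf : IsHydroMap K f) :
    ContinuousOn (invFunOn f UHP) (UHP \ K) := by
  have hop := hydro_isOpen_image hf
  obtain ⟨hd, hinj, himg, hlim⟩ := hf
  intro z hz
  rw [← himg] at hz
  obtain ⟨w, hw, rfl⟩ := hz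
  apply ContinuousAt.continuousWithinAt
  have hleft : ∀ v ∈ UHP, invFunOn f UHP (f v) = v := fun v hv => hinj.leftInvOn_invFunOn hv
  intro s hs
  rw [hleft w hw] at hs
  obtain ⟨t, hts, hto, hwt⟩ := _root_.mem_nhds_iff.1 hs
  rw [Filter.mem_map]
  refine mem_of_superset ((hop (UHP ∩ t) inter_subset_left (isOpen_UHP'.inter hto)).mem_nhds
    ⟨w, ⟨hw, hwt⟩, rfl⟩) ?_
  rintro _ ⟨v, hv, rfl⟩
  show invFunOn f UHP (f v) ∈ s
  rw [hleft v hv.1]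
  exact hts hv.2

lemma tendsto_iy : Tendsto (fun y : ℝ => (y : ℂ) * I) atTop (cobounded ℂ ⊓ 𝓟 UHP) := by
  rw [tendsto_inf, tendsto_principal]
  constructor
  · rw [← tendsto_norm_atTop_iff_cobounded]
    simpa using tendsto_abs_atTop_atTop
  · filter_upwards [eventually_gt_atTop 0] with y hy
    simpa [UHP] using hy

lemma hydro_im_le {K : Set ℂ} {f : ℂ → ℂ} (hf : IsHydroMap K f) :
    ∀ z ∈ UHP, 0 ≤ (f z - z).im := by
  obtain ⟨hd, hinj, himg, hlim⟩ := hf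
  apply im_nonneg_of_compact_sublevel isOpen_UHP' (F := fun z => f z - z)
    (hd.sub differentiableOn_id)
  intro ε hε
  obtain ⟨R, hR⟩ := eventually_cobounded_UHP.1 (hlim.eventually (ball_mem_nhds 0 hε))
  refine ⟨closedBall 0 R ∩ {z | ε ≤ z.im}, (isCompact_closedBall 0 R).inter_right
    (isClosed_le continuous_const Complex.continuous_im), ?_, ?_⟩
  · rintro z ⟨-, hz⟩
    exact lt_of_lt_of_le hε hz
  · intro z hz hle
    have hfz : f z ∈ UHP \ K := himg ▸ mem_image_of_mem f hz
    have h0 : 0 < (f z).im := hfz.1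
    constructor
    · rw [mem_closedBall_zero_iff]
      by_contra hc
      push Not at hc
      have h1 := hR z hz hc.le
      rw [dist_zero_right] at h1
      have h2 := Complex.abs_im_le_norm (f z - z)
      have h3 := neg_abs_le (f z - z).im
      linarith
    · simp only [Complex.sub_im] at hle
      simp only [mem_ofPred_eq]
      linarith

lemma im_jouk (z : ℂ) (x r : ℝ) :
    ((r : ℂ) ^ 2 / (z - x)).im = - (r ^ 2 * z.im / ‖z - x‖ ^ 2) := by
  rw [← Complex.normSq_eq_norm_sq, ← Complex.ofReal_pow, Complex.div_im,
    Complex.ofReal_im, Complex.ofReal_re]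
  simp

lemma hydro_tendsto {K : Set ℂ} {f : ℂ → ℂ} (hf : IsHydroMap K f) (x : ℝ) :
    Tendsto (fun z => f z - x) (cobounded ℂ ⊓ 𝓟 UHP) (cobounded ℂ) := by
  obtain ⟨hd, hinj, himg, hlim⟩ := hf
  rw [← tendsto_norm_atTop_iff_cobounded]
  have h1 : Tendsto (fun z : ℂ => ‖z‖) (cobounded ℂ ⊓ 𝓟 UHP) atTop :=
    tendsto_norm_cobounded_atTop.mono_left inf_le_left
  have h2 := (hlim.sub_const (x : ℂ)).norm.neg
  refine tendsto_atTop_mono ?_ (h1.atTop_add h2)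
  intro z
  have := norm_sub_le (f z - x) (f z - z - x)
  have e : f z - x - (f z - z - x) = z := by ring
  rw [e] at this
  linarith

lemma hydro_im_ge {K : Set ℂ} {f : ℂ → ℂ} {x r : ℝ} (hr : 0 < r) (hf : IsHydroMap K f)
    (hKB : K ⊆ Metric.ball (x : ℂ) r) :
    ∀ z ∈ UHP, r < ‖f z - x‖ → 0 ≤ (z - f z - (r : ℂ) ^ 2 / (f z - x)).im := by
  have hft := hydro_tendsto hf x
  have hbd := hydro_bounded (isBounded_ball.subset hKB) hf
  have hgc := invFunOn_continuousOn hf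
  obtain ⟨hd, hinj, himg, hlim⟩ := hf
  have hleft : ∀ v ∈ UHP, invFunOn f UHP (f v) = v := fun v hv => hinj.leftInvOn_invFunOn hv
  set D : Set ℂ := UHP ∩ (fun z => ‖f z - x‖) ⁻¹' Ioi r with hDdef
  have hDo : IsOpen D :=
    (hd.continuousOn.sub continuousOn_const).norm.isOpen_inter_preimage isOpen_UHP' isOpen_Ioi
  have hfD : DifferentiableOn ℂ f D := hd.mono inter_subset_left
  suffices H : ∀ z ∈ D, 0 ≤ (z - f z - (r : ℂ) ^ 2 / (f z - x)).im from
    fun z hz hzr => H z ⟨hz, hzr⟩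
  apply im_nonneg_of_compact_sublevel hDo (F := fun z => z - f z - (r : ℂ) ^ 2 / (f z - x))
  · refine (differentiableOn_id.sub hfD).sub
      ((differentiableOn_const _).div (hfD.sub (differentiableOn_const _)) ?_)
    intro z hz h0
    have : r < ‖f z - x‖ := hz.2
    rw [h0, norm_zero] at this
    linarith
  intro ε hε
  have hF0 : Tendsto (fun z => z - f z - (r : ℂ) ^ 2 / (f z - x)) (cobounded ℂ ⊓ 𝓟 UHP)
      (nhds 0) := by
    have h1 : Tendsto (fun z => z - f z) (cobounded ℂ ⊓ 𝓟 UHP) (nhds 0) := by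
      simpa using hlim.neg
    have h2 := (tendsto_inv₀_cobounded.comp hft).const_mul ((r : ℂ) ^ 2)
    simpa [div_eq_mul_inv, Function.comp_def] using h1.sub h2
  obtain ⟨R, hR⟩ := eventually_cobounded_UHP.1 (hF0.eventually (ball_mem_nhds 0 hε))
  obtain ⟨M, hM⟩ := hbd R
  set E : Set ℂ := closedBall 0 M ∩ ({z | r ≤ ‖z - x‖} ∩
    {z | ε * ‖z - x‖ ^ 2 ≤ z.im * (‖z - x‖ ^ 2 - r ^ 2)}) with hE
  have hEc : IsCompact E := by
    apply (isCompact_closedBall 0 M).inter_right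
    apply IsClosed.inter
    · exact isClosed_le (by fun_prop) (by fun_prop)
    · exact isClosed_le (by fun_prop) (by fun_prop)
  have hEs : ∀ z ∈ E, z ∈ UHP \ K ∧ r < ‖z - x‖ := by
    rintro z ⟨-, hz1, hz2⟩
    simp only [mem_ofPred_eq] at hz1 hz2
    have hpos : 0 < ε * ‖z - x‖ ^ 2 := mul_pos hε (pow_pos (hr.trans_le hz1) 2)
    have hnn : 0 ≤ ‖z - x‖ ^ 2 - r ^ 2 := by nlinarith
    have hprod := hpos.trans_le hz2
    have him : 0 < z.im := pos_of_mul_pos_left hprod hnn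
    have hlt : r < ‖z - x‖ := by
      refine lt_of_le_of_ne hz1 fun h => ?_
      rw [← h] at hprod
      simp at hprod
    refine ⟨⟨him, fun hk => ?_⟩, hlt⟩
    have := hKB hk
    rw [mem_ball, dist_eq_norm] at this
    linarith
  refine ⟨invFunOn f UHP '' E, hEc.image_of_continuousOn (hgc.mono fun z hz => (hEs z hz).1),
    ?_, ?_⟩
  · rintro _ ⟨z, hz, rfl⟩
    obtain ⟨hzK, hzr⟩ := hEs z hz
    rw [← himg] at hzK
    obtain ⟨w, hw, rfl⟩ := hzK
    rw [hleft w hw]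
    exact ⟨hw, hzr⟩
  · intro w hw hle
    have hwU : 0 < w.im := hw.1
    have hwr : r < ‖f w - x‖ := hw.2
    refine ⟨f w, ⟨?_, hwr.le, ?_⟩, hleft w hw.1⟩
    · rw [mem_closedBall_zero_iff]
      apply hM w hw.1
      by_contra hc
      push Not at hc
      have h1 := hR w hw.1 hc.le
      rw [dist_zero_right] at h1
      have h2 := Complex.abs_im_le_norm (w - f w - (r : ℂ) ^ 2 / (f w - x))
      have h3 := neg_abs_le (w - f w - (r : ℂ) ^ 2 / (f w - x)).im
      linarith
    · rw [Complex.sub_im, Complex.sub_im, im_jouk] at hle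
      simp only [mem_ofPred_eq]
      have hn : 0 < ‖f w - x‖ ^ 2 := pow_pos (hr.trans hwr) 2
      have h4 : ε ≤ (f w).im - r ^ 2 * (f w).im / ‖f w - x‖ ^ 2 := by linarith
      have h5 := mul_le_mul_of_nonneg_right h4 hn.le
      rw [sub_mul, div_mul_cancel₀ _ hn.ne'] at h5
      linarith

/-- **Lemma `supp`(iv).** If `K ⊂ B(x,r)` with `x ∈ ℝ`, then
`0 ≤ hcap(K) ≤ 4r²`. -/
theorem hcap_le_four_radius_sq (K : Set ℂ) (f : ℂ → ℂ) (x r a : ℝ) (hr : 0 < r)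
    (hK : IsHull K) (hf : IsHydroMap K f) (hKB : K ⊆ Metric.ball (x : ℂ) r)
    (ha : HasHcap K f a) :
    0 ≤ a ∧ a ≤ 4 * r ^ 2 := by
  have hlow := hydro_im_le hf
  have hup := hydro_im_ge hr hf hKB
  have hft := hydro_tendsto hf x
  have hT : Tendsto (fun z => z * (z - f z)) (cobounded ℂ ⊓ 𝓟 UHP) (nhds (a : ℂ)) := ha
  have hre : ∀ (y : ℝ) (q : ℂ), ((y : ℂ) * I * q).re = -(y * q.im) := by
    intro y q
    simp
  constructor
  · have h1 := (Complex.continuous_re.tendsto _).comp (hT.comp tendsto_iy)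
    refine ge_of_tendsto h1 ?_
    filter_upwards [eventually_gt_atTop 0] with y hy
    simp only [Function.comp_apply]
    rw [hre]
    have h2 := hlow (y * I) (by simpa [UHP] using hy)
    rw [← neg_sub, Complex.neg_im]
    have := mul_nonneg hy.le h2
    linarith
  · have hlim := hf.2.2.2
    have hq : Tendsto (fun z => z / (f z - x)) (cobounded ℂ ⊓ 𝓟 UHP) (nhds 1) := by
      have h3 := (tendsto_inv₀_cobounded.comp hft)
      have h4 := ((hlim.sub_const (x : ℂ)).mul h3).const_sub 1
      have h5 : Tendsto (fun z => 1 - (f z - z - x) * (f z - x)⁻¹) (cobounded ℂ ⊓ 𝓟 UHP)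
          (nhds 1) := by simpa [Function.comp_def] using h4
      refine h5.congr' ?_
      filter_upwards [hft.eventually (eventually_ne_cobounded 0)] with z hz
      field_simp
      ring
    have hG : Tendsto (fun z => z * (z - f z - (r : ℂ) ^ 2 / (f z - x))) (cobounded ℂ ⊓ 𝓟 UHP)
        (nhds ((a - r ^ 2 : ℝ) : ℂ)) := by
      have h6 := hT.sub (hq.const_mul ((r : ℂ) ^ 2))
      have e : ((a - r ^ 2 : ℝ) : ℂ) = (a : ℂ) - (r : ℂ) ^ 2 * 1 := by push_cast; ring
      rw [e]
      refine h6.congr fun z => ?_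
      ring
    have h1 := (Complex.continuous_re.tendsto _).comp (hG.comp tendsto_iy)
    have h7 : a - r ^ 2 ≤ 0 := by
      refine le_of_tendsto h1 ?_
      have hbig := (tendsto_norm_atTop_iff_cobounded.2 (hft.comp tendsto_iy)).eventually
        (eventually_gt_atTop r)
      filter_upwards [eventually_gt_atTop 0, hbig] with y hy hyr
      simp only [Function.comp_apply] at hyr ⊢
      rw [hre]
      have h2 := hup (y * I) (by simpa [UHP] using hy) hyr
      have := mul_nonneg hy.le h2
      linarith
    nlinarith [sq_nonneg r]
end
end
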